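/- arXiv:2107.01416 — 2 statements merged into one kernel-verified Lean document; each statement's English description precedes it below -/
import Mathlib

section
/- Let n, c, s be integers with n-1 ≥ c ≥ 4 and s ≥ 2. If G is a 2-connected graph of order n with circumference c(G) = c, then N_s(G) ≤ max{f_s(n,c,2), f_s(n,c,⌊c/2⌋)}. -/
open SimpleGraph

/-- The degree of a vertex, as `Nat.card` of its neighbor set. -/
noncomputable def degN {V : Type*} (G : SimpleGraph V) (v : V) : ℕ :=
  Nat.card (G.neighborSet v)

/-- `G` has minimum degree exactly `k`. -/
def MinDegreeEq {V : Type*} (G : SimpleGraph V) (k : ℕ) : Prop :=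
  (∀ v, k ≤ degN G v) ∧ ∃ v, degN G v = k

/-- `G` is 2-connected: at least 3 vertices and deleting any vertex leaves a connected graph. -/
def TwoConnected {V : Type*} (G : SimpleGraph V) : Prop :=
  3 ≤ Nat.card V ∧ ∀ v : V, (G.induce {u | u ≠ v}).Connected

/-- The circumference of `G`: the length of a longest cycle (0 if there are none). -/
noncomputable def circ {V : Type*} (G : SimpleGraph V) : ℕ :=
  sSup {n | ∃ (v : V) (w : G.Walk v v), w.IsCycle ∧ w.length = n}

/-- The detour order of `G`: the number of vertices of a longest path. -/
noncomputable def detour {V : Type*} (G : SimpleGraph V) : ℕ :=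
  sSup {n | ∃ (u v : V) (p : G.Walk u v), p.IsPath ∧ p.length + 1 = n}

/-- The number of cliques of cardinality `s` in `G`. -/
noncomputable def cliquesN {V : Type*} (G : SimpleGraph V) (s : ℕ) : ℕ :=
  Nat.card {S : Finset V // G.IsNClique s S}

/-- The number of edges of `G`. -/
noncomputable def edgeCount {V : Type*} (G : SimpleGraph V) : ℕ :=
  Nat.card G.edgeSet

/-- `G` contains a Hamilton cycle. -/
def IsHamiltonianGr {V : Type*} (G : SimpleGraph V) : Prop :=
  ∃ (v : V) (w : G.Walk v v), w.IsCycle ∧ ∀ u : V, u ∈ w.support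

/-- `G` contains a Hamilton path. -/
def IsTraceableGr {V : Type*} (G : SimpleGraph V) : Prop :=
  ∃ (u v : V) (p : G.Walk u v), p.IsPath ∧ ∀ w : V, w ∈ p.support

/-- `f_s(n,c,k) = C(c+1-k, s) + (n-c-1+k)·C(k, s-1)`. -/
def fCliques (n c k s : ℕ) : ℕ :=
  Nat.choose (c + 1 - k) s + (n + k - c - 1) * Nat.choose k (s - 1)

/-- `g_s(n,c,k) = C(c+1-t, s) + (n-c-2+t)·C(t, s-1) + C(k, s-1)` with `t = ⌊c/2⌋`. -/
def gCliques (n c k s : ℕ) : ℕ :=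
  Nat.choose (c + 1 - c / 2) s + (n + c / 2 - c - 2) * Nat.choose (c / 2) (s - 1)
    + Nat.choose k (s - 1)

/-- `g_s(n,c,k,q) = q·C(k, s-1) + (n-q-c-1+t)·C(t, s-1) + C(c+1-t, s)` with `t = ⌊c/2⌋`. -/
def gCliquesQ (n c k q s : ℕ) : ℕ :=
  q * Nat.choose k (s - 1) + (n + c / 2 - q - c - 1) * Nat.choose (c / 2) (s - 1)
    + Nat.choose (c + 1 - c / 2) s

/-- `F(n,c,k) = K_k ∨ (K_{c+1-2k} + \overline{K_{n-c-1+k}})`, realized on `Fin n`: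
vertices `0,…,k-1` are the dominating clique `K_k`, vertices `k,…,c-k` extend it to
`K_{c+1-k}`, and vertices `c-k+1,…,n-1` form the independent part. -/
def Fgraph (n c k : ℕ) : SimpleGraph (Fin n) where
  Adj x y := x ≠ y ∧ (x.val < k ∨ y.val < k ∨ (x.val ≤ c - k ∧ y.val ≤ c - k))
  symm := ⟨by intro x y h; exact ⟨h.1.symm, by tauto⟩⟩
  loopless := ⟨by intro x h; exact h.1 rfl⟩

/-- `G(n,c,k)`: from `K_t ∨ (K_{c+1-2t} + \overline{K_{n-c-1+t}})` (with `t = ⌊c/2⌋`)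
delete `t-k` edges incident to one common vertex (the vertex `n-1`) of the independent
part, keeping only its `k` neighbors `0,…,k-1`. -/
def Ggraph (n c k : ℕ) : SimpleGraph (Fin n) :=
  (Fgraph n c (c / 2)).deleteEdges
    {e | ∃ x y : Fin n, e = s(x, y) ∧ x.val = n - 1 ∧ k ≤ y.val ∧ y.val < c / 2}

/-- There is a path in `G` from `u` to `v` with vertex set exactly `S`. -/
inductive PS {V : Type} [DecidableEq V] (G : SimpleGraph V) : V → V → Finset V → Prop
  | single (u : V) : PS G u u {u}
  | cons (u w v : V) (S : Finset V) : G.Adj u w → PS G w v S → u ∉ S → PS G u v (insert u S)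

section PSlemmas

variable {V : Type} [DecidableEq V] {G : SimpleGraph V}

theorem PS.left_mem {u v : V} {S : Finset V} (h : PS G u v S) : u ∈ S := by
  cases h <;> simp

theorem PS.right_mem {u v : V} {S : Finset V} (h : PS G u v S) : v ∈ S := by
  induction h with
  | single u => simp
  | cons u w v S h1 h2 h3 ih => exact Finset.mem_insert_of_mem ih

theorem PS.mono {G' : SimpleGraph V} (hle : G ≤ G') {u v : V} {S : Finset V}
    (h : PS G u v S) : PS G' u v S := by
  induction h with
  | single u => exact PS.single u
  | cons u w v S h1 h2 h3 ih => exact PS.cons u w v S (hle h1) ih h3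

theorem PS.trans {u v w : V} {S T : Finset V} (h : PS G u v S) (h' : PS G v w T)
    (hd : ∀ x ∈ S, x ∈ T → x = v) : PS G u w (S ∪ T) := by
  induction h with
  | single u =>
    have : ({u} : Finset V) ∪ T = T := by
      ext x; simp; rintro rfl; exact h'.left_mem
    rw [this]; exact h'
  | cons u a v S h1 h2 h3 ih =>
    have h4 := ih h' (fun x hx => hd x (Finset.mem_insert_of_mem hx))
    rw [Finset.insert_union]
    refine PS.cons u a w _ h1 h4 ?_
    intro hu
    rcases Finset.mem_union.1 hu with hu | hu
    · exact h3 hu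
    · have := hd u (Finset.mem_insert_self _ _) hu
      exact h3 (this ▸ h2.right_mem)

theorem PS.pair {u v : V} (h : G.Adj u v) : PS G u v {u, v} :=
  PS.cons u v v {v} h (PS.single v) (by simpa using h.ne)

theorem PS.snoc {u v w : V} {S : Finset V} (h : PS G u v S) (ha : G.Adj v w) (hw : w ∉ S) :
    PS G u w (insert w S) := by
  have := h.trans (PS.pair ha) (by
    intro x hx hx'
    simp at hx'
    rcases hx' with rfl | rfl
    · rfl
    · exact absurd hx hw)
  have e : S ∪ {v, w} = insert w S := by
    ext x; simp
    rintro rfl; exact Or.inr h.right_mem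
  rwa [e] at this

theorem PS.symm {u v : V} {S : Finset V} (h : PS G u v S) : PS G v u S := by
  induction h with
  | single u => exact PS.single u
  | cons u w v S h1 h2 h3 ih => exact ih.snoc h1.symm h3

theorem PS.append {u v w z : V} {S T : Finset V} (h : PS G u v S) (ha : G.Adj v w)
    (h' : PS G w z T) (hd : Disjoint S T) : PS G u z (S ∪ T) := by
  have hw : w ∉ S := fun hw => Finset.disjoint_left.1 hd hw h'.left_mem
  have := (h.snoc ha hw).trans h' (by
    intro x hx hx'
    rcases Finset.mem_insert.1 hx with rfl | hx
    · rfl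
    · exact absurd hx' (Finset.disjoint_left.1 hd hx))
  have e : insert w S ∪ T = S ∪ T := by
    ext x; simp
    rintro rfl; exact Or.inr h'.left_mem
  rwa [e] at this

/-- suffix -/
theorem PS.suffix {u v z : V} {S : Finset V} (h : PS G u v S) (hz : z ∈ S) :
    ∃ T ⊆ S, PS G z v T ∧ (z ≠ u → u ∉ T) := by
  induction h with
  | single u =>
    simp at hz; subst hz
    exact ⟨{z}, subset_rfl, PS.single z, fun h => absurd rfl h⟩
  | cons u w v S h1 h2 h3 ih =>
    rcases Finset.mem_insert.1 hz with rfl | hz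
    · exact ⟨_, subset_rfl, PS.cons z w v S h1 h2 h3, fun h => absurd rfl h⟩
    · obtain ⟨T, hT, hp, _⟩ := ih hz
      exact ⟨T, hT.trans (Finset.subset_insert _ _), hp, fun _ hu => h3 (hT hu)⟩

theorem PS.initial {u v z : V} {S : Finset V} (h : PS G u v S) (hz : z ∈ S) :
    ∃ T ⊆ S, PS G u z T ∧ (z ≠ v → v ∉ T) := by
  obtain ⟨T, h1, h2, h3⟩ := h.symm.suffix hz
  exact ⟨T, h1, h2.symm, h3⟩

theorem PS.uncons {u v : V} {S : Finset V} (h : PS G u v S) (hne : u ≠ v) :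
    ∃ z T, G.Adj u z ∧ PS G z v T ∧ u ∉ T ∧ S = insert u T := by
  cases h with
  | single => exact absurd rfl hne
  | cons _ w _ T h1 h2 h3 => exact ⟨w, T, h1, h2, h3, rfl⟩

theorem PS.self_eq {u : V} {S : Finset V} (h : PS G u u S) : S = {u} := by
  cases h with
  | single => rfl
  | cons _ w _ T h1 h2 h3 => exact absurd h2.right_mem h3

/-- no long cycles -/
def NL (G : SimpleGraph V) (c : ℕ) : Prop :=
  ∀ u v S, PS G u v S → G.Adj u v → S.card ≤ c

theorem NL.two {c : ℕ} (h : NL G c) {u w : V} {S T : Finset V} (h1 : PS G u w S)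
    (h2 : PS G u w T) (hne : u ≠ w) (hd : ∀ x ∈ S, x ∈ T → x = u ∨ x = w) :
    (S ∪ T).card ≤ c := by
  obtain ⟨z, T', ha, hp, hu, rfl⟩ := h2.uncons hne
  have h3 := h1.trans hp.symm (by
    intro x hx hx'
    rcases hd x hx (Finset.mem_insert_of_mem hx') with rfl | h
    · exact absurd hx' hu
    · exact h)
  have e : S ∪ insert u T' = S ∪ T' := by
    ext x; simp
    rintro rfl; exact Or.inl h1.left_mem
  rw [e]
  exact h _ _ _ h3 ha

/-- 2-connectedness through paths -/
def Conn2 (G : SimpleGraph V) : Prop :=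
  ∀ w x y : V, x ≠ w → y ≠ w → ∃ S, PS G x y S ∧ w ∉ S

theorem Conn2.connect (h : Conn2 G) (w : V) (X Y : Finset V) (hX : X.Nonempty) (hY : Y.Nonempty)
    (hwX : w ∉ X) (hwY : w ∉ Y) :
    ∃ x ∈ X, ∃ y ∈ Y, ∃ S, PS G x y S ∧ w ∉ S ∧ (∀ z ∈ S, z ∈ X → z = x) ∧
      (∀ z ∈ S, z ∈ Y → z = y) := by
  classical
  obtain ⟨x0, hx0⟩ := hX
  obtain ⟨y0, hy0⟩ := hY
  obtain ⟨S0, hS0, hw0⟩ := h w x0 y0 (fun e => hwX (e ▸ hx0)) (fun e => hwY (e ▸ hy0))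
  have hex : ∃ k : ℕ, ∃ x ∈ X, ∃ y ∈ Y, ∃ S, PS G x y S ∧ w ∉ S ∧ S.card = k :=
    ⟨_, x0, hx0, y0, hy0, S0, hS0, hw0, rfl⟩
  obtain ⟨x, hx, y, hy, S, hS, hw, hk⟩ := Nat.find_spec hex
  refine ⟨x, hx, y, hy, S, hS, hw, ?_, ?_⟩
  · intro z hz hzX
    by_contra hne
    obtain ⟨T, hT, hp, hu⟩ := hS.suffix hz
    have hlt : T.card < S.card :=
      Finset.card_lt_card ⟨hT, fun hh => hu hne (hh hS.left_mem)⟩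
    rw [hk] at hlt
    exact Nat.find_min hex hlt ⟨z, hzX, y, hy, T, hp, fun e => hw (hT e), rfl⟩
  · intro z hz hzY
    by_contra hne
    obtain ⟨T, hT, hp, hu⟩ := hS.initial hz
    have hlt : T.card < S.card :=
      Finset.card_lt_card ⟨hT, fun hh => hu hne (hh hS.right_mem)⟩
    rw [hk] at hlt
    exact Nat.find_min hex hlt ⟨x, hx, z, hzY, T, hp, fun e => hw (hT e), rfl⟩

theorem PS.of_walk {w : V} {a b : {u : V | u ≠ w}} (p : (G.induce {u | u ≠ w}).Walk a b) :
    ∃ S, PS G a.1 b.1 S ∧ w ∉ S := by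
  induction p with
  | nil => 
    rename_i u
    exact ⟨_, PS.single _, by simpa using (Ne.symm u.2)⟩
  | cons h p ih =>
    rename_i u x y
    obtain ⟨S, hS, hw⟩ := ih
    by_cases hu : u.1 ∈ S
    · obtain ⟨T, hT, hp, _⟩ := hS.suffix hu
      exact ⟨T, hp, fun e => hw (hT e)⟩
    · refine ⟨_, PS.cons _ _ _ _ h hS hu, ?_⟩
      simp only [Finset.mem_insert, not_or]
      exact ⟨Ne.symm u.2, hw⟩

theorem TwoConnected.conn2 (h : TwoConnected G) : Conn2 G := by
  intro w x y hx hy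
  obtain ⟨p⟩ := (h.2 w).preconnected ⟨x, hx⟩ ⟨y, hy⟩
  exact PS.of_walk p

theorem PS.toWalk {u v : V} {S : Finset V} (h : PS G u v S) :
    ∃ p : G.Walk u v, p.IsPath ∧ ∀ x, x ∈ p.support ↔ x ∈ S := by
  induction h with
  | single u => exact ⟨Walk.nil, by simp, by simp⟩
  | cons u w v S h1 h2 h3 ih =>
    obtain ⟨p, hp, hs⟩ := ih
    refine ⟨Walk.cons h1 p, ?_, ?_⟩
    · rw [Walk.cons_isPath_iff]; exact ⟨hp, fun e => h3 ((hs _).1 e)⟩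
    · intro x; simp [hs]

theorem NL.of_circ [Fintype V] {c : ℕ} (hc : 2 ≤ c) (h : circ G = c) : NL G c := by
  intro u v S hS ha
  by_contra hlt
  push Not at hlt
  obtain ⟨z, T, hz, hp, hu, rfl⟩ := hS.uncons ha.ne
  obtain ⟨p, hp1, hp2⟩ := hp.toWalk
  have hcard : p.length + 1 = T.card := by
    rw [← Walk.length_support, ← List.toFinset_card_of_nodup hp1.support_nodup]
    congr 1; ext x; simp [hp2]
  have hzv : z ≠ v := by
    rintro rfl
    have := hp.self_eq
    rw [Finset.card_insert_of_notMem hu, this] at hlt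
    simp at hlt; omega
  have hcyc : (Walk.cons ha.symm (Walk.cons hz p)).IsCycle := by
    rw [Walk.cons_isCycle_iff]
    constructor
    · rw [Walk.cons_isPath_iff]; exact ⟨hp1, fun e => hu ((hp2 _).1 e)⟩
    · intro he
      rw [Walk.edges_cons, List.mem_cons] at he
      rcases he with he | he
      · rw [Sym2.eq_iff] at he
        rcases he with ⟨h1, h2⟩ | ⟨h1, h2⟩
        · exact ha.ne h1.symm
        · exact hzv h1.symm
      · exact hu ((hp2 _).1 (Walk.snd_mem_support_of_mem_edges _ he))
  have hb : BddAbove {n | ∃ (v : V) (w : G.Walk v v), w.IsCycle ∧ w.length = n} := by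
    refine ⟨Fintype.card V, ?_⟩
    rintro n ⟨v, w, hw, rfl⟩
    have h1 := hw.support_nodup
    have h2 := h1.length_le_card
    simpa using h2
  have := le_csSup hb ⟨v, _, hcyc, rfl⟩
  change _ ≤ circ G at this
  rw [Finset.card_insert_of_notMem hu] at hlt
  simp at this
  omega

theorem PS.add_edge {x y u v : V} {S : Finset V} (h : PS (G ⊔ SimpleGraph.edge x y) u v S) :
    PS G u v S ∨ ∃ a b S1 S2, ((a = x ∧ b = y) ∨ (a = y ∧ b = x)) ∧ PS G u a S1 ∧ PS G b v S2 ∧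
      Disjoint S1 S2 ∧ S = S1 ∪ S2 := by
  induction h with
  | single u => exact Or.inl (PS.single u)
  | cons u w v S h1 h2 h3 ih =>
    by_cases hG : G.Adj u w
    · rcases ih with ih | ⟨a, b, S1, S2, hab, p1, p2, hd, rfl⟩
      · exact Or.inl (PS.cons _ _ _ _ hG ih h3)
      · simp only [Finset.mem_union, not_or] at h3
        refine Or.inr ⟨a, b, insert u S1, S2, hab, PS.cons _ _ _ _ hG p1 h3.1, p2, ?_, ?_⟩
        · rw [Finset.disjoint_insert_left]; exact ⟨h3.2, hd⟩
        · rw [Finset.insert_union]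
    · have hxy : (u = x ∧ w = y) ∨ (u = y ∧ w = x) := by
        rw [sup_adj, edge_adj] at h1
        tauto
      rcases ih with ih | ⟨a, b, S1, S2, hab, p1, p2, hd, rfl⟩
      · refine Or.inr ⟨u, w, {u}, S, hxy, PS.single u, ih, ?_, ?_⟩
        · simpa using h3
        · rfl
      · exfalso
        apply h3
        have := p1.right_mem
        have := p2.left_mem
        simp only [Finset.mem_union]
        rcases hab with ⟨rfl, rfl⟩ | ⟨rfl, rfl⟩ <;> rcases hxy with ⟨rfl, rfl⟩ | ⟨rfl, rfl⟩ <;> tauto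

theorem long_path_of_max {c : ℕ} (hc : 2 ≤ c) (h : NL G c)
    (hmax : ∀ G', NL G' c → G ≤ G' → G' ≤ G) {x y : V} (hne : x ≠ y) (hn : ¬ G.Adj x y) :
    ∃ S, PS G x y S ∧ c + 1 ≤ S.card := by
  have h1 : ¬ NL (G ⊔ SimpleGraph.edge x y) c := by
    intro hh
    have := hmax _ hh le_sup_left
    apply hn
    apply this
    rw [sup_adj, edge_adj]
    exact Or.inr ⟨by simp, hne⟩
  unfold NL at h1
  push Not at h1
  obtain ⟨u, v, S, hS, ha, hlt⟩ := h1
  rcases hS.add_edge with hS' | ⟨a, b, S1, S2, hab, p1, p2, hd, rfl⟩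
  · have : ¬ G.Adj u v := fun hh => absurd (h _ _ _ hS' hh) (by omega)
    rw [sup_adj, edge_adj] at ha
    rcases ha with ha | ⟨⟨rfl, rfl⟩ | ⟨rfl, rfl⟩, _⟩
    · exact absurd ha this
    · exact ⟨S, hS', hlt⟩
    · exact ⟨S, hS'.symm, hlt⟩
  · have key : PS G a b (S1 ∪ S2) := by
      by_cases hG : G.Adj u v
      · exact p1.symm.append hG p2.symm hd
      · exfalso
        have huv : (u = x ∧ v = y) ∨ (u = y ∧ v = x) := by
          rw [sup_adj, edge_adj] at ha
          tauto
        have hx : (u = a ∧ v = b) ∨ (u = b ∧ v = a) := by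
          rcases hab with ⟨rfl, rfl⟩ | ⟨rfl, rfl⟩ <;> tauto
        rcases hx with ⟨rfl, rfl⟩ | ⟨rfl, rfl⟩
        · rw [p1.self_eq, p2.self_eq] at hlt
          have := Finset.card_union_le {u} {v}
          simp only [Finset.card_singleton] at this
          omega
        · exact Finset.disjoint_left.1 hd p1.left_mem p2.left_mem
    rcases hab with ⟨rfl, rfl⟩ | ⟨rfl, rfl⟩
    · exact ⟨_, key, hlt⟩
    · exact ⟨_, key.symm, hlt⟩

theorem exists_max [Fintype V] {c : ℕ} (h : NL G c) :
    ∃ G', G ≤ G' ∧ NL G' c ∧ ∀ G'', NL G'' c → G' ≤ G'' → G'' ≤ G' := by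
  classical
  obtain ⟨G', h1, h2⟩ := (Set.toFinite {H : SimpleGraph V | NL H c}).exists_le_maximal (a := G) h
  exact ⟨G', h1, h2.1, fun G'' h3 h4 => h2.2 h3 h4⟩

/-- enumeration of a path -/
theorem PS.enum {u v : V} {S : Finset V} (h : PS G u v S) :
    ∃ (m : ℕ) (f : ℕ → V), f 0 = u ∧ f m = v ∧ (∀ i < m, G.Adj (f i) (f (i + 1))) ∧
      (∀ i ≤ m, ∀ j ≤ m, f i = f j → i = j) ∧ (∀ z, z ∈ S ↔ ∃ i ≤ m, f i = z) ∧ S.card = m + 1 := by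
  induction h with
  | single u => exact ⟨0, fun _ => u, rfl, rfl, by simp, by simp, by simp [eq_comm], by simp⟩
  | cons u w v S h1 h2 h3 ih =>
    obtain ⟨m, f, f0, fm, fa, fi, fs, fc⟩ := ih
    refine ⟨m + 1, fun i => Nat.casesOn i u f, rfl, fm, ?_, ?_, ?_, ?_⟩
    · rintro (_ | i) hi
      · simpa [f0] using h1
      · exact fa i (by omega)
    · rintro (_ | i) hi (_ | j) hj e
      · rfl
      · exact absurd ((fs u).2 ⟨j, by omega, e.symm⟩) h3
      · exact absurd ((fs u).2 ⟨i, by omega, e⟩) h3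
      · rw [fi i (by omega) j (by omega) e]
    · intro z
      rw [Finset.mem_insert, fs]
      constructor
      · rintro (rfl | ⟨i, hi, rfl⟩)
        · exact ⟨0, by omega, rfl⟩
        · exact ⟨i + 1, by omega, rfl⟩
      · rintro ⟨_ | i, hi, rfl⟩
        · exact Or.inl rfl
        · exact Or.inr ⟨i, by omega, rfl⟩
    · rw [Finset.card_insert_of_notMem h3, fc]

theorem PS.seg {f : ℕ → V} {m : ℕ} (fa : ∀ i < m, G.Adj (f i) (f (i + 1)))
    (fi : ∀ i ≤ m, ∀ j ≤ m, f i = f j → i = j) {i j : ℕ} (hij : i ≤ j) (hj : j ≤ m) :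
    PS G (f i) (f j) ((Finset.Icc i j).image f) := by
  induction j, hij using Nat.le_induction with
  | base => simpa using PS.single (f i)
  | succ j hij ih =>
    have := (ih (by omega)).snoc (fa j (by omega)) (by
      simp only [Finset.mem_image, Finset.mem_Icc, not_exists, not_and]
      intro k hk e
      have := fi _ (by omega) _ (by omega) e
      omega)
    rw [← Finset.image_insert] at this
    have e : insert (j + 1) (Finset.Icc i j) = Finset.Icc i (j + 1) := by
      ext k; simp; omega
    rwa [e] at this

end PSlemmas
section Kopylov

variable {V : Type} [DecidableEq V] {G : SimpleGraph V}

/-- two disjoint paths from the initial part of the path to the final part -/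
def KState (G : SimpleGraph V) (f : ℕ → V) (m a i : ℕ) : Prop :=
  ∃ (R1 R2 : Finset V) (d1 d2 e : ℕ), PS G (f d1) (f i) R1 ∧ PS G (f d2) (f e) R2 ∧
    ((d1 = a ∧ d2 < a) ∨ (d2 = a ∧ d1 < a)) ∧ i < e ∧ e ≤ m ∧ Disjoint R1 R2 ∧
    ∀ k ≤ m, f k ∈ R1 ∪ R2 → (k ≤ a → k = d1 ∨ k = d2) ∧ (i ≤ k → k = i ∨ k = e)

variable {f : ℕ → V} {m : ℕ}

theorem kstate_base (hcon : Conn2 G)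
    (fi : ∀ i ≤ m, ∀ j ≤ m, f i = f j → i = j) {a : ℕ} (ha : 1 ≤ a) (ham : a < m) :
    KState G f m a a := by
  obtain ⟨x, hx, y, hy, S, hS, hw, h1, h2⟩ := hcon.connect (f a) ((Finset.Icc 0 (a - 1)).image f)
    ((Finset.Icc (a + 1) m).image f) ⟨f 0, Finset.mem_image_of_mem _ (by simp)⟩
    ⟨f m, Finset.mem_image_of_mem _ (by simp; omega)⟩
    (by
      simp only [Finset.mem_image, Finset.mem_Icc, not_exists, not_and]
      intro k hk e
      have := fi _ (by omega) _ (by omega) e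
      omega)
    (by
      simp only [Finset.mem_image, Finset.mem_Icc, not_exists, not_and]
      intro k hk e
      have := fi _ (by omega) _ (by omega) e
      omega)
  simp only [Finset.mem_image, Finset.mem_Icc] at hx hy
  obtain ⟨d, hd, rfl⟩ := hx
  obtain ⟨e, he, rfl⟩ := hy
  refine ⟨{f a}, S, a, d, e, PS.single _, hS, Or.inl ⟨rfl, by omega⟩, by omega, by omega,
    by simpa using hw, ?_⟩
  intro k hk hmem
  simp only [Finset.mem_union, Finset.mem_singleton] at hmem
  rcases hmem with hmem | hmem
  · have := fi _ hk _ (by omega) hmem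
    omega
  · have hka : k ≠ a := by rintro rfl; exact hw hmem
    refine ⟨fun hle => Or.inr ?_, fun hle => Or.inr ?_⟩
    · exact fi _ hk _ (by omega) (h1 _ hmem (Finset.mem_image_of_mem _ (by simp; omega)))
    · exact fi _ hk _ (by omega) (h2 _ hmem (Finset.mem_image_of_mem _ (by simp; omega)))

set_option maxHeartbeats 1600000 in
theorem kstate_step (hcon : Conn2 G) (fa : ∀ i < m, G.Adj (f i) (f (i + 1)))
    (fi : ∀ i ≤ m, ∀ j ≤ m, f i = f j → i = j) {a i : ℕ} (ha : 1 ≤ a) (hai : a ≤ i)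
    (him : i + 2 ≤ m) (h : KState G f m a i) : KState G f m a (i + 1) := by
  obtain ⟨R1, R2, d1, d2, e, p1, p2, hd, hie, hem, hdis, hk⟩ := h
  have hdis' := Finset.disjoint_left.1 hdis
  have hR1 : f (i + 1) ∉ R1 := by
    intro hh
    have := (hk (i + 1) (by omega) (Finset.mem_union_left _ hh)).2 (by omega)
    have h2 : i + 1 = e := by omega
    rw [h2] at hh
    exact hdis' hh p2.right_mem
  have p1' := p1.snoc (fa i (by omega)) hR1
  by_cases hj : i + 1 < e
  · have hR2 : f (i + 1) ∉ R2 := by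
      intro hh
      have := (hk (i + 1) (by omega) (Finset.mem_union_right _ hh)).2 (by omega)
      omega
    refine ⟨_, R2, d1, d2, e, p1', p2, hd, hj, hem, ?_, ?_⟩
    · rw [Finset.disjoint_insert_left]; exact ⟨hR2, hdis⟩
    · intro k hkm hmem
      rw [Finset.insert_union, Finset.mem_insert] at hmem
      rcases hmem with hmem | hmem
      · have := fi _ hkm _ (by omega) hmem
        omega
      · have := hk k hkm hmem
        constructor
        · exact this.1
        · intro hle
          have := this.2 (by omega)
          omega
  have he : e = i + 1 := by omega
  subst he
  clear hj hie hem
  -- the connecting path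
  set X : Finset V := ((Finset.Icc 0 a).image f ∪ (R1 ∪ R2)).erase (f (i + 1)) with hX
  obtain ⟨s, hs, y, hy, S, hS, hw, h1, h2⟩ := hcon.connect (f (i + 1)) X
    ((Finset.Icc (i + 2) m).image f)
    ⟨f 0, by
      rw [hX, Finset.mem_erase]
      refine ⟨fun e => ?_, Finset.mem_union_left _ (Finset.mem_image_of_mem _ (by simp))⟩
      have := fi _ (by omega) _ (by omega) e
      omega⟩
    ⟨f m, Finset.mem_image_of_mem _ (by simp; omega)⟩
    (by simp [hX])
    (by
      simp only [Finset.mem_image, Finset.mem_Icc, not_exists, not_and]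
      intro k hk e
      have := fi _ (by omega) _ (by omega) e
      omega)
  simp only [Finset.mem_image, Finset.mem_Icc] at hy
  obtain ⟨j, hj, rfl⟩ := hy
  have hXA : ∀ k ≤ a, f k ∈ X := by
    intro k hk
    rw [hX, Finset.mem_erase]
    refine ⟨fun e => ?_, Finset.mem_union_left _ (Finset.mem_image_of_mem _ (by simp; omega))⟩
    have := fi _ (by omega) _ (by omega) e
    omega
  have hXU : ∀ z ∈ R1 ∪ R2, z ∈ S → z = s := by
    intro z hz hzS
    refine h1 z hzS ?_
    rw [hX, Finset.mem_erase]
    exact ⟨fun e => hw (e ▸ hzS), Finset.mem_union_right _ hz⟩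
  have hSk : ∀ k ≤ m, f k ∈ S → (k ≤ a → f k = s) ∧ (i + 1 ≤ k → k = j) := by
    intro k hkm hmem
    refine ⟨fun hle => h1 _ hmem (hXA k hle), fun hle => ?_⟩
    have : k ≠ i + 1 := by rintro rfl; exact hw hmem
    exact fi _ hkm _ (by omega) (h2 _ hmem (Finset.mem_image_of_mem _ (by simp; omega)))
  have hUk : ∀ k ≤ m, f k ∈ R1 ∪ R2 → (k ≤ a → k = d1 ∨ k = d2) ∧ (i + 1 ≤ k → k = i + 1) := by
    intro k hkm hmem
    have := hk k hkm hmem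
    refine ⟨this.1, fun hle => ?_⟩
    have := this.2 (by omega)
    omega
  have hi1 : ∀ k ≤ m, f k = f (i + 1) → k = i + 1 := fun k hkm e => fi _ hkm _ (by omega) e
  rw [hX, Finset.mem_erase] at hs
  obtain ⟨hsne, hs⟩ := hs
  by_cases hs1 : s ∈ R1
  · obtain ⟨T, hT, q, _⟩ := p1.initial hs1
    have q' := q.trans hS (fun z hz hz' => hXU z (Finset.mem_union_left _ (hT hz)) hz')
    refine ⟨R2, T ∪ S, d2, d1, j, p2, q', by tauto, by omega, by omega, ?_, ?_⟩
    · rw [Finset.disjoint_left]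
      intro z hz hz'
      rcases Finset.mem_union.1 hz' with hz' | hz'
      · exact hdis' (hT hz') hz
      · have := hXU z (Finset.mem_union_right _ hz) hz'
        exact hdis' hs1 (this ▸ hz)
    · intro k hkm hmem
      have : f k ∈ R1 ∪ R2 ∨ f k ∈ S := by
        simp only [Finset.mem_union] at hmem ⊢
        rcases hmem with h | h | h
        · tauto
        · have := hT h; tauto
        · tauto
      rcases this with hu | hu
      · have := hUk k hkm hu
        tauto
      · have := hSk k hkm hu
        refine ⟨fun hle => ?_, fun hle => Or.inr (this.2 hle)⟩
        have h3 := this.1 hle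
        have := (hUk k hkm (h3 ▸ Finset.mem_union_left _ hs1)).1 hle
        tauto
  by_cases hs2 : s ∈ R2
  · obtain ⟨T, hT, q, hTn⟩ := p2.initial hs2
    have hTn := hTn hsne
    have q' := q.trans hS (fun z hz hz' => hXU z (Finset.mem_union_right _ (hT hz)) hz')
    refine ⟨_, T ∪ S, d1, d2, j, p1', q', hd, by omega, by omega, ?_, ?_⟩
    · rw [Finset.disjoint_left]
      intro z hz hz'
      rcases Finset.mem_insert.1 hz with rfl | hz
      · rcases Finset.mem_union.1 hz' with hz' | hz'
        · exact hTn hz'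
        · exact hw hz'
      rcases Finset.mem_union.1 hz' with hz' | hz'
      · exact hdis' hz (hT hz')
      · have := hXU z (Finset.mem_union_left _ hz) hz'
        exact hs1 (this ▸ hz)
    · intro k hkm hmem
      have : f k ∈ R1 ∪ R2 ∨ f k ∈ S ∨ f k = f (i + 1) := by
        simp only [Finset.mem_union, Finset.mem_insert] at hmem ⊢
        rcases hmem with (h | h) | h | h
        · tauto
        · tauto
        · have := hT h; tauto
        · tauto
      rcases this with hu | hu | hu
      · have := hUk k hkm hu
        tauto
      · have := hSk k hkm hu
        refine ⟨fun hle => ?_, fun hle => Or.inr (this.2 hle)⟩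
        have h3 := this.1 hle
        have := (hUk k hkm (h3 ▸ Finset.mem_union_right _ hs2)).1 hle
        tauto
      · have := hi1 k hkm hu
        omega
  -- now `s` lies on the initial segment only
  have hsU : s ∉ R1 ∪ R2 := by simp [hs1, hs2]
  have hs3 : s ∈ (Finset.Icc 0 a).image f := (Finset.mem_union.1 hs).resolve_right hsU
  simp only [Finset.mem_image, Finset.mem_Icc] at hs3
  obtain ⟨d, hda, rfl⟩ := hs3
  have hSU : ∀ z ∈ R1 ∪ R2, z ∉ S := fun z hz hz' => hsU (hXU z hz hz' ▸ hz)
  have hda' : d < a := by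
    rcases lt_or_eq_of_le hda.2 with h | rfl
    · exact h
    · exfalso
      rcases hd with ⟨rfl, _⟩ | ⟨rfl, _⟩
      · exact hs1 p1.left_mem
      · exact hs2 p2.left_mem
  have hR12 : ∀ k ≤ m, f k ∈ R1 → k ≠ d2 := by
    rintro k hkm hh rfl
    exact hdis' hh p2.left_mem
  have hR21 : ∀ k ≤ m, f k ∈ R2 → k ≠ d1 := by
    rintro k hkm hh rfl
    exact hdis' p1.left_mem hh
  rcases hd with ⟨h5, h6⟩ | ⟨h5, h6⟩
  · refine ⟨_, S, d1, d, j, p1', hS, Or.inl ⟨h5, hda'⟩, by omega, by omega, ?_, ?_⟩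
    · rw [Finset.disjoint_left]
      intro z hz hz'
      rcases Finset.mem_insert.1 hz with rfl | hz
      · exact hw hz'
      · exact hSU z (Finset.mem_union_left _ hz) hz'
    · intro k hkm hmem
      simp only [Finset.mem_union, Finset.mem_insert] at hmem
      rcases hmem with (hu | hu) | hu
      · have := hi1 k hkm hu
        omega
      · have := hUk k hkm (Finset.mem_union_left _ hu)
        have := hR12 k hkm hu
        tauto
      · have := hSk k hkm hu
        refine ⟨fun hle => Or.inr (fi _ hkm _ (by omega) (this.1 hle)),
          fun hle => Or.inr (this.2 hle)⟩
  · refine ⟨R2, S, d2, d, j, p2, hS, Or.inl ⟨h5, hda'⟩, by omega, by omega, ?_, ?_⟩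
    · rw [Finset.disjoint_left]
      intro z hz hz'
      exact hSU z (Finset.mem_union_right _ hz) hz'
    · intro k hkm hmem
      simp only [Finset.mem_union] at hmem
      rcases hmem with hu | hu
      · have := hUk k hkm (Finset.mem_union_right _ hu)
        have := hR21 k hkm hu
        tauto
      · have := hSk k hkm hu
        refine ⟨fun hle => Or.inr (fi _ hkm _ (by omega) (this.1 hle)),
          fun hle => Or.inr (this.2 hle)⟩

theorem kstate_all (hcon : Conn2 G) (fa : ∀ i < m, G.Adj (f i) (f (i + 1)))
    (fi : ∀ i ≤ m, ∀ j ≤ m, f i = f j → i = j) {a b : ℕ} (ha : 1 ≤ a) (hab : a ≤ b)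
    (hbm : b < m) : KState G f m a b := by
  induction b, hab using Nat.le_induction with
  | base => exact kstate_base hcon fi ha hbm
  | succ i hi ih => exact kstate_step hcon fa fi ha hi (by omega) (ih (by omega))

set_option maxHeartbeats 1600000 in
open Classical in
/-- Kopylov's lemma -/
theorem kopylov {c : ℕ} (hnl : NL G c) (hcon : Conn2 G) (fa : ∀ i < m, G.Adj (f i) (f (i + 1)))
    (fi : ∀ i ≤ m, ∀ j ≤ m, f i = f j → i = j) (hcm : c ≤ m) (hm : 1 ≤ m)
    (hdeg : c + 1 ≤ ((Finset.Icc 1 m).filter (fun i => G.Adj (f 0) (f i))).card +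
      ((Finset.Icc 0 (m - 1)).filter (fun i => G.Adj (f m) (f i))).card) : False := by
  set Nx := (Finset.Icc 1 m).filter (fun i => G.Adj (f 0) (f i)) with hNx
  set Ny := (Finset.Icc 0 (m - 1)).filter (fun i => G.Adj (f m) (f i)) with hNy
  have mx : ∀ i, i ∈ Nx ↔ (1 ≤ i ∧ i ≤ m) ∧ G.Adj (f 0) (f i) := by intro i; simp [hNx]
  have my : ∀ i, i ∈ Ny ↔ i ≤ m - 1 ∧ G.Adj (f m) (f i) := by intro i; simp [hNy]
  have cardim : ∀ A : Finset ℕ, (∀ i ∈ A, i ≤ m) → (A.image f).card = A.card := by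
    intro A hA
    apply Finset.card_image_of_injOn
    intro i hi j hj e
    exact fi _ (hA i hi) _ (hA j hj) e
  by_cases hcr : ∃ d : ℕ, ∃ i ∈ Ny, ∃ j ∈ Nx, j = i + 1 + d
  · obtain ⟨i, hi, j, hj, hd⟩ := Nat.find_spec hcr
    have hmin := fun d' (h : d' < Nat.find hcr) => Nat.find_min hcr h
    set d := Nat.find hcr with hdd
    clear_value d
    have hi' := (my i).1 hi
    have hj' := (mx j).1 hj
    have p := (PS.seg fa fi (i := 0) (j := i) (by omega) (by omega)).append hi'.2.symm
      (PS.seg fa fi (i := j) (j := m) (by omega) le_rfl).symm (by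
        rw [Finset.disjoint_left]
        intro z hz hz'
        simp only [Finset.mem_image, Finset.mem_Icc] at hz hz'
        obtain ⟨k, hk, rfl⟩ := hz
        obtain ⟨l, hl, e⟩ := hz'
        have := fi _ (by omega) _ (by omega) e
        omega)
    have hc1 := hnl _ _ _ p hj'.2
    rw [← Finset.image_union, cardim _ (by intro k hk; simp at hk; omega),
      Finset.card_union_of_disjoint (by
        rw [Finset.disjoint_left]; intro z hz hz'; simp at hz hz'; omega)] at hc1
    simp only [Nat.card_Icc] at hc1
    have hd1 : 1 ≤ d := by omega
    -- counting
    have hsub : Nx ∪ Ny.image (· + 1) ⊆ Finset.Icc 1 (i + 1) ∪ Finset.Icc j m := by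
      intro e he
      simp only [Finset.mem_union, Finset.mem_image, Finset.mem_Icc] at he ⊢
      rcases he with he | ⟨k, hk, rfl⟩
      · have h1 := (mx e).1 he
        by_contra hcon
        exact hmin (e - (i + 1)) (by omega) ⟨i, hi, e, he, by omega⟩
      · have h1 := (my k).1 hk
        by_contra hcon
        exact hmin (j - (k + 1)) (by omega) ⟨k, hk, j, hj, by omega⟩
    have hdisj : Disjoint Nx (Ny.image (· + 1)) := by
      rw [Finset.disjoint_left]
      intro e he he'
      simp only [Finset.mem_image] at he'
      obtain ⟨k, hk, rfl⟩ := he'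
      exact hmin 0 (by omega) ⟨k, hk, _, he, rfl⟩
    have h3 := Finset.card_le_card hsub
    rw [Finset.card_union_of_disjoint hdisj,
      Finset.card_image_of_injective _ (fun x y h => by simpa using h)] at h3
    have h4 := Finset.card_union_le (Finset.Icc 1 (i + 1)) (Finset.Icc j m)
    simp only [Nat.card_Icc] at h4
    omega
  · have hnc : ∀ i ∈ Ny, ∀ j ∈ Nx, j ≤ i := by
      intro i hi j hj
      by_contra hlt
      exact hcr ⟨j - (i + 1), i, hi, j, hj, by omega⟩
    have nx : Nx.Nonempty := ⟨1, (mx 1).2 ⟨⟨le_rfl, hm⟩, fa 0 (by omega)⟩⟩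
    have ny : Ny.Nonempty := ⟨m - 1, (my _).2 ⟨le_rfl, by
      have := fa (m - 1) (by omega)
      rw [Nat.sub_add_cancel hm] at this
      exact this.symm⟩⟩
    obtain ⟨a, haN, hamax⟩ : ∃ a ∈ Nx, ∀ j ∈ Nx, j ≤ a :=
      ⟨Nx.max' nx, Nx.max'_mem nx, fun j hj => Nx.le_max' j hj⟩
    obtain ⟨b, hbN, hbmin⟩ : ∃ b ∈ Ny, ∀ j ∈ Ny, b ≤ j :=
      ⟨Ny.min' ny, Ny.min'_mem ny, fun j hj => Ny.min'_le j hj⟩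
    have hab := hnc b hbN a haN
    have ha' := (mx a).1 haN
    have hb' := (my b).1 hbN
    obtain ⟨R1, R2, d1, d2, e, p1, p2, hd, hie, hem, hdis, hk⟩ :=
      kstate_all hcon fa fi ha'.1.1 hab (by omega)
    have hdis' := Finset.disjoint_left.1 hdis
    -- path on the initial side
    have hA : ∀ i0 < a, ∃ I : Finset ℕ, (∀ k ∈ I, k ≤ a) ∧ 0 ∈ I ∧ Nx ⊆ I ∧
        PS G (f i0) (f a) (I.image f) := by
      intro i0 hi0
      have ne : (Nx.filter (fun k => i0 < k)).Nonempty := ⟨a, by simp [haN, hi0]⟩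
      obtain ⟨h, hh, hhmin⟩ : ∃ h ∈ Nx.filter (fun k => i0 < k),
          ∀ j ∈ Nx.filter (fun k => i0 < k), h ≤ j :=
        ⟨_, Finset.min'_mem _ ne, fun j hj => Finset.min'_le _ j hj⟩
      rw [Finset.mem_filter] at hh
      have hh1 := (mx h).1 hh.1
      have hh2 := hamax h hh.1
      refine ⟨Finset.Icc 0 i0 ∪ Finset.Icc h a, ?_, ?_, ?_, ?_⟩
      · intro k hk; simp at hk; omega
      · simp
      · intro k hk
        have := hamax k hk
        simp only [Finset.mem_union, Finset.mem_Icc]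
        by_cases hki : i0 < k
        · have := hhmin k (by simp [hk, hki])
          omega
        · omega
      · rw [Finset.image_union]
        refine (PS.seg fa fi (i := 0) (j := i0) (by omega) (by omega)).symm.append hh1.2
          (PS.seg fa fi hh2 (by omega)) ?_
        rw [Finset.disjoint_left]
        intro z hz hz'
        simp only [Finset.mem_image, Finset.mem_Icc] at hz hz'
        obtain ⟨k, hk, rfl⟩ := hz
        obtain ⟨l, hl, e⟩ := hz'
        have := fi _ (by omega) _ (by omega) e
        omega
    have hB : ∃ J : Finset ℕ, (∀ k ∈ J, b ≤ k ∧ k ≤ m) ∧ m ∈ J ∧ Ny ⊆ J ∧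
        PS G (f b) (f e) (J.image f) := by
      have ne : (Ny.filter (fun k => k < e)).Nonempty := ⟨b, by simp [hbN, hie]⟩
      obtain ⟨h, hh, hhmax⟩ : ∃ h ∈ Ny.filter (fun k => k < e),
          ∀ j ∈ Ny.filter (fun k => k < e), j ≤ h :=
        ⟨_, Finset.max'_mem _ ne, fun j hj => Finset.le_max' _ j hj⟩
      rw [Finset.mem_filter] at hh
      have hh1 := (my h).1 hh.1
      have hh2 := hbmin h hh.1
      refine ⟨Finset.Icc b h ∪ Finset.Icc e m, ?_, ?_, ?_, ?_⟩
      · intro k hk; simp at hk; omega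
      · simp; omega
      · intro k hk
        have := hbmin k hk
        have := (my k).1 hk
        simp only [Finset.mem_union, Finset.mem_Icc]
        by_cases hki : k < e
        · have := hhmax k (by simp [hk, hki])
          omega
        · omega
      · rw [Finset.image_union]
        refine (PS.seg fa fi hh2 (by omega)).append hh1.2.symm
          (PS.seg fa fi (i := e) (j := m) (by omega) (by omega)).symm ?_
        rw [Finset.disjoint_left]
        intro z hz hz'
        simp only [Finset.mem_image, Finset.mem_Icc] at hz hz'
        obtain ⟨k, hk, rfl⟩ := hz
        obtain ⟨l, hl, e⟩ := hz'
        have := fi _ (by omega) _ (by omega) e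
        omega
    have hA' : ∃ I : Finset ℕ, (∀ k ∈ I, k ≤ a) ∧ 0 ∈ I ∧ Nx ⊆ I ∧
        PS G (f d2) (f d1) (I.image f) := by
      rcases hd with ⟨h5, h6⟩ | ⟨h5, h6⟩
      · obtain ⟨I, q1, q2, q3, q4⟩ := hA d2 h6
        exact ⟨I, q1, q2, q3, h5 ▸ q4⟩
      · obtain ⟨I, q1, q2, q3, q4⟩ := hA d1 h6
        exact ⟨I, q1, q2, q3, h5 ▸ q4.symm⟩
    obtain ⟨I, I1, I2, I3, I4⟩ := hA'
    obtain ⟨J, J1, J2, J3, J4⟩ := hB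
    have q1 := I4.trans p1 (by
      intro z hz hz'
      simp only [Finset.mem_image] at hz
      obtain ⟨k, hkI, rfl⟩ := hz
      have := I1 k hkI
      rcases (hk k (by omega) (Finset.mem_union_left _ hz')).1 this with rfl | rfl
      · rfl
      · exact absurd p2.left_mem (hdis' hz'))
    have q2 := q1.trans J4 (by
      intro z hz hz'
      simp only [Finset.mem_image] at hz'
      obtain ⟨k, hkJ, rfl⟩ := hz'
      have hkb := J1 k hkJ
      rcases Finset.mem_union.1 hz with hz | hz
      · simp only [Finset.mem_image] at hz
        obtain ⟨l, hl, e⟩ := hz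
        have := I1 l hl
        have := fi _ (by omega) _ (by omega) e
        have : k = b := by omega
        rw [this]
      · rcases (hk k (by omega) (Finset.mem_union_left _ hz)).2 hkb.1 with rfl | rfl
        · rfl
        · exact absurd p2.right_mem (hdis' hz))
    have h8 := hnl.two q2 p2 (fun e => by
        have := fi _ (by omega) _ (by omega) e
        omega) (by
      intro z hz hz'
      simp only [Finset.mem_union] at hz
      rcases hz with (hz | hz) | hz
      · simp only [Finset.mem_image] at hz
        obtain ⟨k, hkI, rfl⟩ := hz
        have := I1 k hkI
        rcases (hk k (by omega) (Finset.mem_union_right _ hz')).1 this with rfl | rfl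
        · exact absurd hz' (hdis' p1.left_mem)
        · exact Or.inl rfl
      · exact absurd hz' (hdis' hz)
      · simp only [Finset.mem_image] at hz
        obtain ⟨k, hkJ, rfl⟩ := hz
        have hkb := J1 k hkJ
        rcases (hk k (by omega) (Finset.mem_union_right _ hz')).2 hkb.1 with rfl | rfl
        · exact absurd hz' (hdis' p1.right_mem)
        · exact Or.inr rfl)
    -- counting
    have hsub : (insert 0 Nx ∪ (insert m Ny).erase a).image f ⊆
        I.image f ∪ R1 ∪ J.image f ∪ R2 := by
      intro z hz
      simp only [Finset.mem_image, Finset.mem_union, Finset.mem_insert, Finset.mem_erase] at hz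
      obtain ⟨k, hkk, rfl⟩ := hz
      simp only [Finset.mem_union]
      rcases hkk with (rfl | hkk) | ⟨_, rfl | hkk⟩
      · exact Or.inl (Or.inl (Or.inl (Finset.mem_image_of_mem _ I2)))
      · exact Or.inl (Or.inl (Or.inl (Finset.mem_image_of_mem _ (I3 hkk))))
      · exact Or.inl (Or.inr (Finset.mem_image_of_mem _ J2))
      · exact Or.inl (Or.inr (Finset.mem_image_of_mem _ (J3 hkk)))
    have h9 := Finset.card_le_card hsub
    rw [cardim _ (by
        intro k hk
        simp only [Finset.mem_union, Finset.mem_insert, Finset.mem_erase] at hk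
        rcases hk with (rfl | hk) | ⟨_, rfl | hk⟩
        · omega
        · exact ((mx k).1 hk).1.2
        · exact le_rfl
        · have := (my k).1 hk; omega),
      Finset.card_union_of_disjoint (by
        rw [Finset.disjoint_left]
        intro k hk hk'
        simp only [Finset.mem_insert, Finset.mem_erase] at hk hk'
        have h1 : k ≤ a := by
          rcases hk with rfl | hk
          · omega
          · exact hamax k hk
        have h2 : b ≤ k := by
          rcases hk'.2 with rfl | hk
          · omega
          · exact hbmin k hk
        omega),
      Finset.card_insert_of_notMem (by intro h; have := (mx 0).1 h; omega)] at h9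
    have h10 : (insert m Ny).card - 1 ≤ ((insert m Ny).erase a).card := Finset.pred_card_le_card_erase
    rw [Finset.card_insert_of_notMem (by intro h; have := (my m).1 h; omega)] at h10
    omega

end Kopylov
section Main

variable {V : Type} [DecidableEq V] [Fintype V] {G : SimpleGraph V}

open Classical in
theorem no_pair {c : ℕ} (hc : 2 ≤ c) (hnl : NL G c) (hcon : Conn2 G)
    (hmax : ∀ G', NL G' c → G ≤ G' → G' ≤ G) (X Y : Finset V) (dx dy : ℕ)
    (hsum : c + 1 ≤ dx + dy)
    (hX : ∀ x ∈ X, ∀ y ∈ Y, x ≠ y → ¬ G.Adj x y →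
      dx ≤ (Finset.univ.filter (fun z => G.Adj x z ∧ (z ∈ X ∨ G.Adj y z))).card)
    (hY : ∀ x ∈ X, ∀ y ∈ Y, x ≠ y → ¬ G.Adj x y →
      dy ≤ (Finset.univ.filter (fun z => G.Adj y z ∧ (z ∈ Y ∨ G.Adj x z))).card) :
    ∀ x ∈ X, ∀ y ∈ Y, x ≠ y → G.Adj x y := by
  intro x0 hx0 y0 hy0 hne0
  by_contra hna0
  obtain ⟨S0, hS0, hc0⟩ := long_path_of_max hc hnl hmax hne0 hna0
  obtain ⟨S, hSm, hSmax⟩ := (Finset.univ.filter (fun S : Finset V =>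
    ∃ x ∈ X, ∃ y ∈ Y, x ≠ y ∧ ¬ G.Adj x y ∧ PS G x y S)).exists_max_image Finset.card
    ⟨S0, by simp only [Finset.mem_filter, Finset.mem_univ, true_and]
            exact ⟨x0, hx0, y0, hy0, hne0, hna0, hS0⟩⟩
  simp only [Finset.mem_filter, Finset.mem_univ, true_and] at hSm hSmax
  obtain ⟨x, hx, y, hy, hne, hna, hS⟩ := hSm
  have hcS : c + 1 ≤ S.card := hc0.trans (hSmax S0 ⟨x0, hx0, y0, hy0, hne0, hna0, hS0⟩)
  have e1 : ∀ z, G.Adj x z ∧ (z ∈ X ∨ G.Adj y z) → z ∈ S := by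
    rintro z ⟨hz1, hz2⟩
    by_contra hzS
    have p := PS.cons z x y S hz1.symm hS hzS
    have hcard := Finset.card_insert_of_notMem hzS
    by_cases hyz : G.Adj y z
    · have := hnl _ _ _ p hyz.symm
      omega
    · have := hSmax _ ⟨z, hz2.resolve_right hyz, y, hy, fun e => hzS (e ▸ hS.right_mem),
        fun e => hyz e.symm, p⟩
      omega
  have e2 : ∀ z, G.Adj y z ∧ (z ∈ Y ∨ G.Adj x z) → z ∈ S := by
    rintro z ⟨hz1, hz2⟩
    by_contra hzS
    have p := hS.snoc hz1 hzS
    have hcard := Finset.card_insert_of_notMem hzS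
    by_cases hyz : G.Adj x z
    · have := hnl _ _ _ p hyz
      omega
    · have := hSmax _ ⟨x, hx, z, hz2.resolve_right hyz, fun e => hzS (e ▸ hS.left_mem), hyz, p⟩
      omega
  have hdx := hX x hx y hy hne hna
  have hdy := hY x hx y hy hne hna
  obtain ⟨m, f, rfl, rfl, fa, fi, fs, fc⟩ := hS.enum
  refine kopylov hnl hcon fa fi (by omega) (by omega) (hsum.trans (add_le_add (hdx.trans ?_)
    (hdy.trans ?_)))
  · refine (Finset.card_le_card (t := ((Finset.Icc 1 m).filter
      (fun i => G.Adj (f 0) (f i))).image f) ?_).trans Finset.card_image_le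
    intro z hz
    simp only [Finset.mem_filter, Finset.mem_univ, true_and] at hz
    obtain ⟨i, hi, rfl⟩ := (fs z).1 (e1 z hz)
    have : i ≠ 0 := by rintro rfl; exact G.irrefl hz.1
    refine Finset.mem_image_of_mem _ ?_
    simp only [Finset.mem_filter, Finset.mem_Icc]
    exact ⟨by omega, hz.1⟩
  · refine (Finset.card_le_card (t := ((Finset.Icc 0 (m - 1)).filter
      (fun i => G.Adj (f m) (f i))).image f) ?_).trans Finset.card_image_le
    intro z hz
    simp only [Finset.mem_filter, Finset.mem_univ, true_and] at hz
    obtain ⟨i, hi, rfl⟩ := (fs z).1 (e2 z hz)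
    have : i ≠ m := by rintro rfl; exact G.irrefl hz.1
    refine Finset.mem_image_of_mem _ ?_
    simp only [Finset.mem_filter, Finset.mem_Icc]
    exact ⟨by omega, hz.1⟩

open Classical in
/-- the `d`-core of `G` -/
noncomputable def coreF (G : SimpleGraph V) (d : ℕ) : Finset V :=
  Finset.univ.filter (fun v => ∃ S : Finset V, v ∈ S ∧ ∀ u ∈ S, d ≤ (S.filter (G.Adj u)).card)

open Classical in
theorem core_max {d : ℕ} {S : Finset V} (h : ∀ u ∈ S, d ≤ (S.filter (G.Adj u)).card) :
    S ⊆ coreF G d := by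
  intro v hv
  simp only [coreF, Finset.mem_filter, Finset.mem_univ, true_and]
  exact ⟨S, hv, h⟩

open Classical in
theorem core_deg {d : ℕ} {u : V} (h : u ∈ coreF G d) :
    d ≤ ((coreF G d).filter (G.Adj u)).card := by
  have h' := h
  simp only [coreF, Finset.mem_filter, Finset.mem_univ, true_and] at h'
  obtain ⟨S, hu, hS⟩ := h'
  exact (hS u hu).trans (Finset.card_le_card (Finset.filter_subset_filter _ (core_max hS)))

open Classical in
theorem core_anti {d e : ℕ} (h : d ≤ e) : coreF G e ⊆ coreF G d :=
  core_max (fun _ hu => h.trans (core_deg hu))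

open Classical in
/-- number of `s`-cliques inside `S` -/
noncomputable def clq (G : SimpleGraph V) (s : ℕ) (S : Finset V) : ℕ :=
  ((S.powersetCard s).filter (fun T : Finset V => G.IsClique (T : Set V))).card

open Classical in
theorem clq_erase {s p : ℕ} {S : Finset V} {v : V} (hv : v ∈ S)
    (hd : (S.filter (G.Adj v)).card ≤ p) :
    clq G s S ≤ clq G s (S.erase v) + Nat.choose p (s - 1) := by
  unfold clq
  rw [← Finset.card_filter_add_card_filter_not (s := (S.powersetCard s).filter
    (fun T : Finset V => G.IsClique (T : Set V))) (fun T : Finset V => v ∉ T)]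
  apply add_le_add
  · apply Finset.card_le_card
    intro T hT
    simp only [Finset.mem_filter, Finset.mem_powersetCard] at hT ⊢
    refine ⟨⟨fun x hx => Finset.mem_erase.2 ⟨fun e => hT.2 (e ▸ hx), hT.1.1.1 hx⟩, hT.1.1.2⟩, hT.1.2⟩
  · refine le_trans ?_ (Nat.choose_le_choose (s - 1) hd)
    rw [← Finset.card_powersetCard]
    apply Finset.card_le_card_of_injOn (fun T : Finset V => T.erase v)
    · intro T hT
      simp only [Finset.coe_filter, Finset.mem_filter, Finset.mem_powersetCard, not_not,
        Set.mem_ofPred_eq] at hT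
      simp only [Finset.mem_coe, Finset.mem_powersetCard]
      refine ⟨?_, ?_⟩
      · intro x hx
        rw [Finset.mem_erase] at hx
        rw [Finset.mem_filter]
        exact ⟨hT.1.1.1 hx.2, hT.1.2 hT.2 hx.2 (Ne.symm hx.1)⟩
      · rw [Finset.card_erase_of_mem hT.2, hT.1.1.2]
    · intro T hT T' hT' e
      simp only [Finset.coe_filter, Finset.mem_filter, Finset.mem_powersetCard, not_not,
        Set.mem_ofPred_eq] at hT hT'
      simp only at e
      rw [← Finset.insert_erase hT.2, e, Finset.insert_erase hT'.2]

open Classical in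
theorem peel {s p B : ℕ} {H : Finset V}
    (h : ∀ S, H ⊆ S → B < S.card → ∃ v ∈ S, v ∉ H ∧ (S.filter (G.Adj v)).card ≤ p) :
    ∀ (k : ℕ) (S : Finset V), H ⊆ S → S.card = B + k →
      clq G s S ≤ Nat.choose B s + k * Nat.choose p (s - 1) := by
  intro k
  induction k with
  | zero =>
    intro S hS hc
    unfold clq
    refine (Finset.card_le_card (Finset.filter_subset _ _)).trans ?_
    rw [Finset.card_powersetCard, hc]
    simp
  | succ k ih =>
    intro S hS hc
    obtain ⟨v, hv, hvH, hd⟩ := h S hS (by omega)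
    have h1 := clq_erase (s := s) hv hd
    have h2 := ih (S.erase v) (fun x hx => Finset.mem_erase.2 ⟨fun e => hvH (e ▸ hx), hS hx⟩)
      (by rw [Finset.card_erase_of_mem hv]; omega)
    rw [Nat.succ_mul]
    omega

open Classical in
theorem core_peel {p : ℕ} (S : Finset V) (hS : coreF G (p + 1) ⊆ S)
    (hlt : (coreF G (p + 1)) ≠ S) :
    ∃ v ∈ S, v ∉ coreF G (p + 1) ∧ (S.filter (G.Adj v)).card ≤ p := by
  by_contra hcon
  push Not at hcon
  apply hlt
  refine Finset.Subset.antisymm hS (core_max ?_)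
  intro u hu
  by_cases huc : u ∈ coreF G (p + 1)
  · exact (core_deg huc).trans (Finset.card_le_card (Finset.filter_subset_filter _ hS))
  · exact hcon u hu huc

theorem clique_path {S : Finset V} (h : G.IsClique (S : Set V)) :
    ∀ u ∈ S, ∃ v ∈ S, PS G u v S := by
  induction S using Finset.induction_on with
  | empty => simp
  | insert a S ha ih =>
    have hS : G.IsClique (S : Set V) := h.subset (by simp)
    intro u hu
    by_cases hne : S.Nonempty
    · obtain ⟨b, hb⟩ := hne
      have key : ∃ v ∈ S, PS G a v (insert a S) := by
        obtain ⟨v, hv, hp⟩ := ih hS b hb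
        exact ⟨v, hv, PS.cons a b v S (h (by simp) (by simp [hb])
          (fun e => ha (e ▸ hb))) hp ha⟩
      rcases Finset.mem_insert.1 hu with rfl | hu
      · obtain ⟨v, hv, hp⟩ := key
        exact ⟨v, Finset.mem_insert_of_mem hv, hp⟩
      · obtain ⟨v, hv, hp⟩ := ih hS u hu
        exact ⟨a, by simp, hp.snoc (h (by simp [hv]) (by simp) (fun e => ha (e ▸ hv))) ha⟩
    · rw [Finset.not_nonempty_iff_eq_empty] at hne
      subst hne
      simp at hu
      subst hu
      exact ⟨u, by simp, by simpa using PS.single u⟩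

theorem clique_card_le {c : ℕ} (hc : 1 ≤ c) (hnl : NL G c) {S : Finset V}
    (h : G.IsClique (S : Set V)) : S.card ≤ c := by
  by_contra hlt
  push Not at hlt
  obtain ⟨u, hu⟩ : S.Nonempty := Finset.card_pos.1 (by omega)
  obtain ⟨v, hv, hp⟩ := clique_path h u hu
  have hne : u ≠ v := by
    rintro rfl
    have := hp.self_eq
    rw [this] at hlt
    simp at hlt; omega
  have := hnl _ _ _ hp (h hu hv hne)
  omega

open Classical in
theorem min_deg_two (hcon : Conn2 G) (hV : 3 ≤ Fintype.card V) (v : V) :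
    2 ≤ ((Finset.univ : Finset V).filter (G.Adj v)).card := by
  have nb : ∀ w, w ≠ v → ∃ u, G.Adj v u ∧ u ≠ w := by
    intro w hw
    obtain ⟨y, hy⟩ : ∃ y, y ∉ ({v, w} : Finset V) := by
      by_contra hh
      push Not at hh
      have h1 : (Finset.univ : Finset V) ⊆ {v, w} := fun y _ => hh y
      have h2 := Finset.card_le_card h1
      have h3 := Finset.card_le_two (a := v) (b := w)
      rw [Finset.card_univ] at h2
      omega
    simp at hy
    obtain ⟨S, hS, hwS⟩ := hcon w v y (Ne.symm hw) hy.2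
    obtain ⟨z, T, hz, hp, _, rfl⟩ := hS.uncons (Ne.symm hy.1)
    exact ⟨z, hz, fun e => hwS (Finset.mem_insert_of_mem (e ▸ hp.left_mem))⟩
  obtain ⟨w, hw⟩ : ∃ w, w ≠ v := by
    have : 1 < Fintype.card V := by omega
    exact Fintype.exists_ne_of_one_lt_card this v
  obtain ⟨u, hu, _⟩ := nb w hw
  obtain ⟨u', hu', hne⟩ := nb u hu.ne'
  have h2 : ({u, u'} : Finset V) ⊆ (Finset.univ : Finset V).filter (G.Adj v) := by
    intro z hz
    simp at hz ⊢
    rcases hz with rfl | rfl <;> assumption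
  have := Finset.card_le_card h2
  rwa [Finset.card_pair (Ne.symm hne)] at this

theorem convex_max (a : ℕ → ℤ) (t p : ℕ) (h2 : 2 ≤ p) (hpt : p ≤ t)
    (h : ∀ i, i + 1 < t → a (i + 1) - a i ≤ a (i + 2) - a (i + 1)) :
    a p ≤ max (a 2) (a t) := by
  have hmon : ∀ i j, i ≤ j → j < t → a (i + 1) - a i ≤ a (j + 1) - a j := by
    intro i j hij
    induction j, hij using Nat.le_induction with
    | base => intro _; exact le_rfl
    | succ j hij ih =>
      intro hj
      exact (ih (by omega)).trans (h j hj)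
  rcases eq_or_lt_of_le hpt with rfl | hlt
  · exact le_max_right _ _
  by_cases hD : 0 ≤ a (p + 1) - a p
  · refine le_trans ?_ (le_max_right _ _)
    have : ∀ j, p ≤ j → j ≤ t → a p ≤ a j := by
      intro j hj
      induction j, hj using Nat.le_induction with
      | base => intro _; exact le_rfl
      | succ j hj ih =>
        intro hjt
        have h1 := ih (by omega)
        have h2 := hmon p j hj (by omega)
        linarith
    exact this t hpt le_rfl
  · refine le_trans ?_ (le_max_left _ _)
    have : ∀ j, 2 ≤ j → j ≤ p → a j ≤ a 2 := by
      intro j hj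
      induction j, hj using Nat.le_induction with
      | base => intro _; exact le_rfl
      | succ j hj ih =>
        intro hjt
        have h1 := ih (by omega)
        have h2 := hmon j p (by omega) hlt
        linarith
    exact this p h2 le_rfl

theorem f_convex (n c p s : ℕ) (hn : c + 1 ≤ n) (hs : 2 ≤ s) (h2 : 2 ≤ p) (hp : p ≤ c / 2) :
    fCliques n c p s ≤ max (fCliques n c 2 s) (fCliques n c (c / 2) s) := by
  have key := convex_max (fun i => (fCliques n c i s : ℤ)) (c / 2) p h2 hp (by
    intro i hi
    obtain ⟨N, rfl⟩ := Nat.exists_eq_add_of_le hn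
    obtain ⟨q, rfl⟩ := Nat.exists_eq_add_of_le hs
    obtain ⟨D, hD⟩ := Nat.exists_eq_add_of_le (show i + 2 ≤ c by omega)
    simp only [fCliques]
    have a0 : c + 1 - i = (D + 2) + 1 := by omega
    have a1 : c + 1 - (i + 1) = (D + 1) + 1 := by omega
    have a2 : c + 1 - (i + 2) = D + 1 := by omega
    have b0 : c + 1 + N + i - c - 1 = N + i := by omega
    have b1 : c + 1 + N + (i + 1) - c - 1 = N + i + 1 := by omega
    have b2 : c + 1 + N + (i + 2) - c - 1 = N + i + 2 := by omega
    have e1 : 2 + q = (q + 1) + 1 := by omega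
    have e2 : 2 + q - 1 = q + 1 := by omega
    rw [a0, a1, a2, b0, b1, b2, e2, e1]
    have c1 := Nat.choose_succ_succ' (D + 2) (q + 1)
    have c2 := Nat.choose_succ_succ' (D + 1) (q + 1)
    have c3 := Nat.choose_succ_succ' i q
    have c4 := Nat.choose_succ_succ' (i + 1) q
    have d1 : Nat.choose (D + 1) (q + 1) ≤ Nat.choose (D + 2) (q + 1) :=
      Nat.choose_le_choose _ (by omega)
    have d2 : Nat.choose i q ≤ Nat.choose (i + 1) q := Nat.choose_le_choose _ (by omega)
    rw [c1, show D + 2 = D + 1 + 1 by rfl, c2, show i + 2 = i + 1 + 1 by rfl, c4, c3]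
    rw [show D + 2 = D + 1 + 1 by rfl] at d1
    generalize Nat.choose (D + 1) (q + 1) = x1 at *
    generalize Nat.choose (D + 1 + 1) (q + 1) = x2 at *
    generalize Nat.choose (D + 1) (q + 1 + 1) = x3 at *
    generalize Nat.choose (i + 1) q = y2 at *
    generalize Nat.choose i q = y1 at *
    generalize Nat.choose i (q + 1) = y3 at *
    push_cast
    have d1' : (x1 : ℤ) ≤ x2 := by exact_mod_cast d1
    have d2' : (y1 : ℤ) ≤ y2 := by exact_mod_cast d2
    have hNi : (0 : ℤ) ≤ (N : ℤ) + i := by positivity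
    have hy1 : (0 : ℤ) ≤ y1 := by positivity
    nlinarith [mul_le_mul_of_nonneg_left d2' hNi])
  exact_mod_cast key

set_option maxHeartbeats 1600000 in
open Classical in
theorem main_bound {n c s : ℕ} (hn : Fintype.card V = n) (h1 : c + 1 ≤ n) (h2 : 4 ≤ c)
    (h3 : 2 ≤ s) (hnl : NL G c) (hcon : Conn2 G) (hmax : ∀ G', NL G' c → G ≤ G' → G' ≤ G) :
    clq G s Finset.univ ≤ max (fCliques n c 2 s) (fCliques n c (c / 2) s) := by
  set t := c / 2 with ht
  set H := coreF G (t + 1) with hH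
  by_cases hemp : H = ∅
  · -- empty core
    refine le_trans ?_ (le_max_right _ _)
    have := peel (G := G) (s := s) (p := t) (B := c + 1 - t) (H := ∅) (by
      intro S _ hS
      have hne : (∅ : Finset V) ≠ S := by rintro rfl; simp at hS
      obtain ⟨v, hv, _, hd⟩ := core_peel (G := G) (p := t) S (by rw [← hH, hemp]; simp)
        (by rw [← hH, hemp]; exact hne)
      exact ⟨v, hv, by simp, hd⟩) (n + t - c - 1) Finset.univ (by simp)
      (by rw [Finset.card_univ, hn]; omega)
    exact this
  -- the core is a clique
  have hHcl : ∀ x ∈ H, ∀ y ∈ H, x ≠ y → G.Adj x y := by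
    refine no_pair (by omega) hnl hcon hmax H H (t + 1) (t + 1) (by omega) ?_ ?_
    · intro x hx y hy _ _
      refine (core_deg hx).trans (Finset.card_le_card ?_)
      intro z hz
      rw [Finset.mem_filter] at hz
      simp only [Finset.mem_filter, Finset.mem_univ, true_and]
      exact ⟨hz.2, Or.inl hz.1⟩
    · intro x hx y hy _ _
      refine (core_deg hy).trans (Finset.card_le_card ?_)
      intro z hz
      rw [Finset.mem_filter] at hz
      simp only [Finset.mem_filter, Finset.mem_univ, true_and]
      exact ⟨hz.2, Or.inl hz.1⟩
  have hcl : G.IsClique (H : Set V) := fun x hx y hy hne => hHcl x hx y hy hne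
  have hrc := clique_card_le (by omega) hnl hcl
  have hHdeg : ∀ x ∈ H, (H.filter (G.Adj x)).card = H.card - 1 := by
    intro x hx
    rw [← Finset.card_erase_of_mem hx]
    congr 1
    ext z
    simp only [Finset.mem_filter, Finset.mem_erase]
    constructor
    · rintro ⟨h, h'⟩; exact ⟨h'.ne', h⟩
    · rintro ⟨h, h'⟩; exact ⟨h', hHcl x hx z h' (Ne.symm h)⟩
  obtain ⟨x0, hx0⟩ := Finset.nonempty_iff_ne_empty.2 hemp
  have hrt : t + 2 ≤ H.card := by
    have e1 := core_deg hx0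
    have e2 := hHdeg x0 hx0
    rw [← hH] at e1
    omega
  obtain ⟨p, hp⟩ : ∃ p, H.card + p = c + 1 := ⟨c + 1 - H.card, by omega⟩
  have hpt : p ≤ t := by omega
  set L := coreF G (p + 1) with hL
  have hHL : H ⊆ L := core_anti (by omega)
  have hLH : L = H := by
    refine Finset.Subset.antisymm ?_ hHL
    intro y hy
    by_contra hyH
    have hall : ∀ x ∈ H, ∀ y ∈ L \ H, x ≠ y → G.Adj x y := by
      refine no_pair (by omega) hnl hcon hmax H (L \ H) (H.card - 1) (p + 1) (by omega) ?_ ?_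
      · intro x hx y hy _ _
        rw [← hHdeg x hx]
        refine Finset.card_le_card ?_
        intro z hz
        rw [Finset.mem_filter] at hz
        simp only [Finset.mem_filter, Finset.mem_univ, true_and]
        exact ⟨hz.2, Or.inl hz.1⟩
      · intro x hx y hy _ hna
        refine (core_deg (Finset.mem_sdiff.1 hy).1).trans (Finset.card_le_card ?_)
        intro z hz
        rw [Finset.mem_filter] at hz
        simp only [Finset.mem_filter, Finset.mem_univ, true_and, Finset.mem_sdiff]
        refine ⟨hz.2, ?_⟩
        by_cases hzH : z ∈ H
        · right
          refine hHcl x hx z hzH ?_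
          rintro rfl
          exact hna hz.2.symm
        · exact Or.inl ⟨hz.1, hzH⟩
    apply hyH
    have hgood : insert y H ⊆ coreF G (t + 1) := by
      apply core_max
      intro u hu
      rcases Finset.mem_insert.1 hu with rfl | hu
      · have : H ⊆ (insert u H).filter (G.Adj u) := by
          intro z hz
          rw [Finset.mem_filter]
          exact ⟨Finset.mem_insert_of_mem hz, (hall z hz u (Finset.mem_sdiff.2 ⟨hy, hyH⟩)
            (fun e => hyH (e ▸ hz))).symm⟩
        have := Finset.card_le_card this
        omega
      · exact (core_deg hu).trans (Finset.card_le_card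
          (Finset.filter_subset_filter _ (Finset.subset_insert _ _)))
    exact hgood (Finset.mem_insert_self _ _)
  have hp2 : 2 ≤ p := by
    by_contra hlt
    have : (Finset.univ : Finset V) ⊆ L := by
      apply core_max
      intro u _
      have := min_deg_two hcon (by omega) u
      omega
    rw [hLH] at this
    have := Finset.card_le_card this
    rw [Finset.card_univ] at this
    omega
  refine le_trans ?_ (f_convex n c p s h1 h3 hp2 hpt)
  have hB : H.card = c + 1 - p := by omega
  have := peel (G := G) (s := s) (p := p) (B := c + 1 - p) (H := L) (by
    intro S hS hlt
    exact core_peel S hS (by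
      intro e
      rw [← hL] at e
      rw [← e, hLH] at hlt
      omega)) (n + p - c - 1) Finset.univ (by simp)
      (by rw [Finset.card_univ, hn]; omega)
  exact this

open Classical in
theorem cliquesN_eq (s : ℕ) : cliquesN G s = clq G s Finset.univ := by
  unfold cliquesN clq
  rw [Nat.card_eq_fintype_card]
  rw [Fintype.card_subtype]
  apply congrArg Finset.card
  ext T
  simp only [Finset.mem_filter, Finset.mem_univ, true_and, Finset.mem_powersetCard,
    isNClique_iff, Finset.subset_univ]
  tauto

open Classical in
theorem clq_mono {G' : SimpleGraph V} (h : G ≤ G') (s : ℕ) (S : Finset V) :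
    clq G s S ≤ clq G' s S := by
  unfold clq
  apply Finset.card_le_card
  intro T hT
  simp only [Finset.mem_filter] at hT ⊢
  exact ⟨hT.1, hT.2.mono h⟩

end Main

theorem stmt17 (n c s : ℕ) (h1 : c ≤ n - 1) (h2 : 4 ≤ c) (h3 : 2 ≤ s)
    (V : Type) (G : SimpleGraph V) (hV : Nat.card V = n) (hconn : TwoConnected G)
    (hcirc : circ G = c) :
    cliquesN G s ≤ max (fCliques n c 2 s) (fCliques n c (c / 2) s) := by
  classical
  have hfin : Finite V := Nat.finite_of_card_ne_zero (by have := hconn.1; omega)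
  have : Fintype V := Fintype.ofFinite V
  obtain ⟨G', hle, hnl, hmax⟩ := exists_max (NL.of_circ (by omega) hcirc)
  have hcon : Conn2 G' := by
    intro w x y hx hy
    obtain ⟨S, hS, hw⟩ := hconn.conn2 w x y hx hy
    exact ⟨S, hS.mono hle, hw⟩
  rw [cliquesN_eq]
  refine (clq_mono hle s _).trans (main_bound ?_ (by omega) h2 h3 hnl hcon hmax)
  rw [← hV, Nat.card_eq_fintype_card]
end

section
/- Let n, c, k, s be integers with n-1 ≥ c ≥ 4, s ≥ 2 and k ≥ 2. If G is a 2-connected graph of order n with circumference c(G) = c and minimum degree δ(G) ≥ k, then N_s(G) ≤ max{f_s(n,c,k), f_s(n,c,⌊c/2⌋)}. -/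
open SimpleGraph

/-- `S` is the vertex set of a path from `u` to `w`. -/
def PS_s18 {V : Type} (G : SimpleGraph V) (u w : V) (S : Set V) : Prop :=
  ∃ p : G.Walk u w, p.IsPath ∧ ∀ x, x ∈ p.support ↔ x ∈ S

section
variable {V : Type} {G : SimpleGraph V}

theorem PS_s18.refl (u : V) : PS_s18 G u u {u} := ⟨Walk.nil, by simp, by simp⟩

theorem PS_s18.symm {u w : V} {S : Set V} (h : PS_s18 G u w S) : PS_s18 G w u S := by
  obtain ⟨p, hp, hS⟩ := h
  exact ⟨p.reverse, hp.reverse, by simpa using hS⟩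

theorem PS_s18.left {u w : V} {S : Set V} (h : PS_s18 G u w S) : u ∈ S := by
  obtain ⟨p, hp, hS⟩ := h
  exact (hS u).1 (by simp)

theorem PS_s18.right {u w : V} {S : Set V} (h : PS_s18 G u w S) : w ∈ S := h.symm.left

theorem PS_s18.edge {u w : V} (h : G.Adj u w) : PS_s18 G u w {u, w} :=
  ⟨Walk.cons h Walk.nil, by simp [h.ne], by simp⟩

theorem PS_s18.congr {u w : V} {S T : Set V} (h : PS_s18 G u w S) (hT : ∀ x, x ∈ S ↔ x ∈ T) :
    PS_s18 G u w T := by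
  obtain ⟨p, hp, hS⟩ := h
  exact ⟨p, hp, fun x => (hS x).trans (hT x)⟩

theorem PS_s18.glue {u w z : V} {S T : Set V} (h : PS_s18 G u w S) (h' : PS_s18 G w z T)
    (hd : ∀ x, x ∈ S → x ∈ T → x = w) : PS_s18 G u z (S ∪ T) := by
  obtain ⟨p, hp, hS⟩ := h
  obtain ⟨q, hq, hT⟩ := h'
  refine ⟨p.append q, ?_, by intro x; simp [hS, hT]⟩
  rw [Walk.isPath_def, Walk.support_append, List.nodup_append']
  refine ⟨hp.support_nodup, hq.support_nodup.tail, ?_⟩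
  intro x hx hx'
  have h1 := hd x ((hS x).1 hx) ((hT x).1 (List.mem_of_mem_tail hx'))
  subst h1
  have := hq.support_nodup
  rw [← q.cons_tail_support] at this
  exact (List.nodup_cons.1 this).1 hx'

theorem PS_s18.glue2 {u w w' z : V} {S T : Set V} (h : PS_s18 G u w S) (h' : PS_s18 G w' z T)
    (hw : G.Adj w w') (hd : ∀ x, x ∈ S → x ∉ T) : PS_s18 G u z (S ∪ T) := by
  have hr := h.right
  have hl := h'.left
  have h1 : PS_s18 G u w' (S ∪ {w, w'}) := h.glue (PS_s18.edge hw) (by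
    intro x hx hx'
    rcases hx' with rfl | rfl
    · rfl
    · exact absurd hl (hd _ hx))
  have h2 := h1.glue h' (by
    intro x hx hx'
    rcases hx with hx | rfl | rfl
    · exact absurd hx' (hd _ hx)
    · exact absurd hx' (hd _ hr)
    · rfl)
  refine h2.congr ?_
  intro x
  simp only [Set.mem_union, Set.mem_insert_iff, Set.mem_singleton_iff]
  constructor
  · rintro ((h | rfl | rfl) | h) <;> simp_all
  · rintro (h | h) <;> simp_all

theorem PS_s18.extend {u w z : V} {S : Set V} (h : PS_s18 G u w S) (hw : G.Adj w z) (hz : z ∉ S) :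
    PS_s18 G u z (S ∪ {z}) :=
  h.glue2 (PS_s18.refl z) hw (by rintro x hx rfl; exact hz hx)

theorem PS_s18.split {u w z : V} {S : Set V} (h : PS_s18 G u w S) (hz : z ∈ S) :
    ∃ S1 S2, PS_s18 G u z S1 ∧ PS_s18 G z w S2 ∧ (∀ x, x ∈ S ↔ x ∈ S1 ∨ x ∈ S2) ∧
      (∀ x, x ∈ S1 → x ∈ S2 → x = z) := by
  classical
  obtain ⟨p, hp, hS⟩ := h
  have hz' := (hS z).2 hz
  refine ⟨{x | x ∈ (p.takeUntil z hz').support}, {x | x ∈ (p.dropUntil z hz').support},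
    ⟨_, hp.takeUntil hz', fun x => Iff.rfl⟩, ⟨_, hp.dropUntil hz', fun x => Iff.rfl⟩, ?_, ?_⟩
  · intro x
    rw [← hS]
    conv_lhs => rw [← p.take_spec hz']
    rw [Walk.mem_support_append_iff]
    rfl
  · intro x hx hx'
    by_contra hne
    rw [← p.take_spec hz'] at hp
    exact hp.ne_of_mem_support_of_append hne hx hx' rfl

/-- Two paths with common endpoints close up to a cycle. -/
theorem PS_s18.close [Finite V] {u w : V} {S T : Set V} (h : PS_s18 G u w S) (h' : PS_s18 G w u T)
    (hne : u ≠ w) (hd : ∀ x, x ∈ S → x ∈ T → x = u ∨ x = w) (hc : 3 ≤ (S ∪ T).ncard) :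
    ∃ (x : V) (c : G.Walk x x), c.IsCycle ∧ c.length = (S ∪ T).ncard := by
  classical
  have hu := h.left
  have hw := h.right
  have hu' := h'.right
  have hw' := h'.left
  obtain ⟨p, hp, hS⟩ := h
  obtain ⟨q, hq, hT⟩ := h'
  have card : ∀ {a b : V} (r : G.Walk a b), r.IsPath → ∀ R : Set V, (∀ x, x ∈ r.support ↔ x ∈ R) →
      R.ncard = r.length + 1 := by
    intro a b r hr R hR
    have : R = (r.support.toFinset : Set V) := by ext x; simp [hR]
    rw [this, Set.ncard_coe_finset, List.toFinset_card_of_nodup hr.support_nodup,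
      Walk.length_support]
  have c1 := card p hp S hS
  have c2 := card q hq T hT
  have hI : S ∩ T = {u, w} := by
    ext x
    constructor
    · rintro ⟨a, b⟩
      exact hd x a b
    · rintro (rfl | rfl)
      · exact ⟨hu, hu'⟩
      · exact ⟨hw, hw'⟩
  have c3 := Set.ncard_union_add_ncard_inter S T (Set.toFinite _) (Set.toFinite _)
  rw [hI, Set.ncard_pair hne] at c3
  refine ⟨u, p.append q, ?_, by rw [Walk.length_append]; omega⟩
  apply hp.isCycle_append hq
  · intro x hx hx'
    have n1 := hp.support_nodup
    rw [← p.cons_tail_support] at n1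
    have n2 := hq.support_nodup
    rw [← q.cons_tail_support] at n2
    rcases hd x ((hS x).1 (List.mem_of_mem_tail hx)) ((hT x).1 (List.mem_of_mem_tail hx')) with e | e
    · subst e; exact (List.nodup_cons.1 n1).1 hx
    · subst e; exact (List.nodup_cons.1 n2).1 hx'
  · omega

/-- Connection avoiding a vertex `z`. -/
theorem PS_s18.connect (z : V) (hz : (G.induce {u | u ≠ z}).Connected) (X Y : Set V)
    {x0 y0 : V} (hx0 : x0 ∈ X) (hy0 : y0 ∈ Y) (hxz : x0 ≠ z) (hyz : y0 ≠ z) :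
    ∃ x y W, x ∈ X ∧ y ∈ Y ∧ PS_s18 G x y W ∧ z ∉ W ∧ (∀ t ∈ W, t ∈ X → t = x) ∧
      (∀ t ∈ W, t ∈ Y → t = y) := by
  classical
  have hex : ∃ n : ℕ, ∃ x y, x ∈ X ∧ y ∈ Y ∧ ∃ p : G.Walk x y, p.IsPath ∧ z ∉ p.support ∧
      p.length = n := by
    obtain ⟨p⟩ := hz.preconnected ⟨x0, hxz⟩ ⟨y0, hyz⟩
    let q := p.map (Embedding.induce {u | u ≠ z}).toHom
    have hq : z ∉ q.support := by
      intro h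
      simp only [q, Walk.support_map, List.mem_map] at h
      obtain ⟨a, ha, h⟩ := h
      exact a.2 h
    exact ⟨_, x0, y0, hx0, hy0, q.bypass, q.bypass_isPath, fun h => hq (q.support_bypass_subset_support h), rfl⟩
  obtain ⟨x, y, hx, hy, p, hp, hzp, hl⟩ := Nat.find_spec hex
  have hmin := fun n (hn : n < Nat.find hex) => Nat.find_min hex hn
  refine ⟨x, y, {t | t ∈ p.support}, hx, hy, ⟨p, hp, fun x => Iff.rfl⟩, hzp, ?_, ?_⟩
  · intro t ht htX
    by_contra hne
    refine hmin (p.dropUntil t ht).length ?_ ⟨t, y, htX, hy, _, hp.dropUntil ht, fun h => hzp (p.support_dropUntil_subset_support ht h), rfl⟩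
    rw [← hl]
    have := congrArg Walk.length (p.take_spec ht)
    rw [Walk.length_append] at this
    have : (p.takeUntil t ht).length ≠ 0 := fun h => hne (Walk.eq_of_length_eq_zero h).symm
    omega
  · intro t ht htY
    by_contra hne
    refine hmin (p.takeUntil t ht).length ?_ ⟨x, t, hx, htY, _, hp.takeUntil ht, fun h => hzp (p.support_takeUntil_subset_support ht h), rfl⟩
    rw [← hl]
    have := congrArg Walk.length (p.take_spec ht)
    rw [Walk.length_append] at this
    have : (p.dropUntil t ht).length ≠ 0 := fun h => hne (Walk.eq_of_length_eq_zero h)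
    omega

/-- Segments of a path. -/
theorem PS_s18.seg {v : ℕ → V} {L : ℕ} (hinj : ∀ i j, i ≤ L → j ≤ L → v i = v j → i = j)
    (hadj : ∀ i, i < L → G.Adj (v i) (v (i + 1))) (i j : ℕ) (hij : i ≤ j) (hj : j ≤ L) :
    PS_s18 G (v i) (v j) {x | ∃ t, i ≤ t ∧ t ≤ j ∧ v t = x} := by
  induction j, hij using Nat.le_induction with
  | base =>
    refine (PS_s18.refl (v i)).congr fun x => ⟨?_, ?_⟩
    · rintro rfl; exact ⟨i, le_rfl, le_rfl, rfl⟩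
    · rintro ⟨t, h1, h2, rfl⟩
      have : t = i := by omega
      subst this; rfl
  | succ j hij ih =>
    refine ((ih (by omega)).extend (hadj j (by omega)) ?_).congr fun x => ⟨?_, ?_⟩
    · rintro ⟨t, h1, h2, h⟩
      have := hinj _ _ (by omega) (by omega) h
      omega
    · rintro (⟨t, h1, h2, h⟩ | h)
      · exact ⟨t, h1, by omega, h⟩
      · exact ⟨j + 1, by omega, le_rfl, h.symm⟩
    · rintro ⟨t, h1, h2, h⟩
      by_cases ht : t ≤ j
      · exact Or.inl ⟨t, h1, ht, h⟩
      · have : t = j + 1 := by omega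
        subst this
        exact Or.inr h.symm
end
section
variable {V : Type} {G : SimpleGraph V}

/-- Two disjoint paths from `{v i | i ≤ a}` to `{v i | i ≥ j}`. -/
def Vine (G : SimpleGraph V) (v : ℕ → V) (L a j : ℕ) : Prop :=
  ∃ (p q : ℕ) (sa sb : V) (RA RB : Set V), p < a ∧ j < q ∧ q ≤ L ∧
    ((sa = v a ∧ sb = v p) ∨ (sa = v p ∧ sb = v a)) ∧
    PS_s18 G sa (v j) RA ∧ PS_s18 G sb (v q) RB ∧ (∀ x, x ∈ RA → x ∉ RB) ∧
    (∀ i, i ≤ a → (v i ∈ RA ∨ v i ∈ RB) → i = a ∨ i = p) ∧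
    (∀ i, j ≤ i → i ≤ L → (v i ∈ RA ∨ v i ∈ RB) → i = j ∨ i = q)

theorem vine_base (hG : ∀ z : V, (G.induce {u | u ≠ z}).Connected) {v : ℕ → V} {L a : ℕ}
    (hinj : ∀ i j, i ≤ L → j ≤ L → v i = v j → i = j)
    (ha : 0 < a) (haL : a < L) : Vine G v L a a := by
  obtain ⟨x, y, W, ⟨p, hp, rfl⟩, ⟨q, hq, hqL, rfl⟩, hW, hz, hX, hY⟩ :=
    PS_s18.connect (v a) (hG (v a)) {x | ∃ i, i < a ∧ v i = x} {x | ∃ i, a < i ∧ i ≤ L ∧ v i = x}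
      (x0 := v 0) (y0 := v L) ⟨0, ha, rfl⟩ ⟨L, haL, le_rfl, rfl⟩
      (fun h => by have := hinj _ _ (by omega) (by omega) h; omega)
      (fun h => by have := hinj _ _ (by omega) (by omega) h; omega)
  refine ⟨p, q, v a, v p, {v a}, W, hp, hq, hqL, Or.inl ⟨rfl, rfl⟩, PS_s18.refl _, hW, ?_, ?_, ?_⟩
  · rintro x rfl; exact hz
  · rintro i hi (h | h)
    · exact Or.inl (hinj _ _ (by omega) (by omega) h)
    · by_cases hia : i = a
      · exact Or.inl hia
      · exact Or.inr (hinj _ _ (by omega) (by omega) (hX _ h ⟨i, by omega, rfl⟩))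
  · rintro i hi hiL (h | h)
    · exact Or.inl (hinj _ _ (by omega) (by omega) h)
    · by_cases hia : i = a
      · exact Or.inl hia
      · exact Or.inr (hinj _ _ (by omega) (by omega) (hY _ h ⟨i, by omega, hiL, rfl⟩))

theorem vine_step (hG : ∀ z : V, (G.induce {u | u ≠ z}).Connected) {v : ℕ → V} {L a j : ℕ}
    (hinj : ∀ i j, i ≤ L → j ≤ L → v i = v j → i = j)
    (hadj : ∀ i, i < L → G.Adj (v i) (v (i + 1)))
    (ha : 0 < a) (haj : a ≤ j) (hjL : j + 1 < L) (h : Vine G v L a j) : Vine G v L a (j + 1) := by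
  obtain ⟨p, q, sa, sb, RA, RB, hp, hq, hqL, hs, hA, hB, hd, h1, h2⟩ := h
  have hvj := hA.right
  have hvq := hB.right
  have hsaA := hA.left
  have hsbB := hB.left
  by_cases hq1 : q = j + 1
  swap
  · have hn : v (j + 1) ∉ RA := fun hh => by
      have := h2 (j + 1) (by omega) (by omega) (Or.inl hh); omega
    have hn' : v (j + 1) ∉ RB := fun hh => by
      have := h2 (j + 1) (by omega) (by omega) (Or.inr hh); omega
    refine ⟨p, q, sa, sb, _, RB, hp, by omega, hqL, hs, hA.extend (hadj j (by omega)) hn, hB, ?_, ?_, ?_⟩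
    · rintro x (hx | rfl)
      · exact hd x hx
      · exact hn'
    · rintro i hi ((h | h) | h)
      · exact h1 i hi (Or.inl h)
      · have := hinj _ _ (by omega) (by omega) h; omega
      · exact h1 i hi (Or.inr h)
    · rintro i hi hiL ((h | h) | h)
      · have := h2 i (by omega) hiL (Or.inl h); omega
      · exact Or.inl (hinj _ _ (by omega) (by omega) h)
      · have := h2 i (by omega) hiL (Or.inr h); omega
  subst hq1
  have hn : v (j + 1) ∉ RA := fun hh => hd _ hh hvq
  have hvjB : v j ∉ RB := hd _ hvj
  have hAe := hA.extend (hadj j (by omega)) hn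
  obtain ⟨w, y, W, hw, ⟨q', hq', hqL', rfl⟩, hW, hz, hX, hY⟩ :=
    PS_s18.connect (v (j + 1)) (hG (v (j + 1))) {x | (∃ i, i ≤ a ∧ v i = x) ∨ x ∈ RA ∨ x ∈ RB}
      {x | ∃ i, j + 1 < i ∧ i ≤ L ∧ v i = x}
      (x0 := v 0) (y0 := v L) (Or.inl ⟨0, by omega, rfl⟩) ⟨L, by omega, le_rfl, rfl⟩
      (fun h => by have := hinj _ _ (by omega) (by omega) h; omega)
      (fun h => by have := hinj _ _ (by omega) (by omega) h; omega)
  have hwW := hW.left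
  have hwne : w ≠ v (j + 1) := fun h => hz (h ▸ hwW)
  have hXi : ∀ i, i ≤ a → v i ∈ W → v i = w := fun i hi h => hX _ h (Or.inl ⟨i, hi, rfl⟩)
  have hXA : ∀ x, x ∈ RA → x ∈ W → x = w := fun x hx h => hX _ h (Or.inr (Or.inl hx))
  have hXB : ∀ x, x ∈ RB → x ∈ W → x = w := fun x hx h => hX _ h (Or.inr (Or.inr hx))
  have hYi : ∀ i, j + 1 ≤ i → i ≤ L → v i ∈ W → i = q' := by
    intro i hi hiL h
    by_cases e : i = j + 1
    · subst e; exact absurd h hz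
    · exact hinj _ _ hiL hqL' (hY _ h ⟨i, by omega, hiL, rfl⟩)
  have e1 : ∀ i, i ≤ a → v i ∈ RA ∪ {v (j + 1)} → v i ∈ RA := by
    rintro i hi (h | h)
    · exact h
    · have := hinj _ _ (by omega) (by omega) h; omega
  have e2 : ∀ i, j + 1 ≤ i → i ≤ L → v i ∈ RA ∪ {v (j + 1)} → i = j + 1 := by
    rintro i hi hiL (h | h)
    · have h3 := h2 i (by omega) hiL (Or.inl h); omega
    · exact hinj _ _ (by omega) (by omega) h
  have e3 : ∀ i, j + 1 ≤ i → i ≤ L → v i ∈ RB → i = j + 1 := by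
    rintro i hi hiL h
    have h3 := h2 i (by omega) hiL (Or.inr h); omega
  by_cases hwA : w ∈ RA
  · obtain ⟨S1, S2, hS1, hS2, hS, hSd⟩ := hA.split hwA
    have hsub : ∀ x, x ∈ S1 → x ∈ RA := fun x hx => (hS x).2 (Or.inl hx)
    have hglue := hS1.glue hW (fun x hx hx' => hXA x (hsub x hx) hx')
    refine ⟨p, q', sb, sa, RB, _, hp, hq', hqL', by tauto, hB, hglue, ?_, ?_, ?_⟩
    · rintro x hx (hx' | hx')
      · exact hd x (hsub x hx') hx
      · exact hd w hwA (hXB x hx hx' ▸ hx)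
    · rintro i hi (h | h | h)
      · exact h1 i hi (Or.inr h)
      · exact h1 i hi (Or.inl (hsub _ h))
      · exact h1 i hi (Or.inl (hXi i hi h ▸ hwA))
    · rintro i hi hiL (h | h | h)
      · exact Or.inl (e3 i hi hiL h)
      · exact Or.inl (e2 i hi hiL (Or.inl (hsub _ h)))
      · exact Or.inr (hYi i hi hiL h)
  by_cases hwB : w ∈ RB
  · obtain ⟨S1, S2, hS1, hS2, hS, hSd⟩ := hB.split hwB
    have hsub : ∀ x, x ∈ S1 → x ∈ RB := fun x hx => (hS x).2 (Or.inl hx)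
    have hglue := hS1.glue hW (fun x hx hx' => hXB x (hsub x hx) hx')
    have hnS : v (j + 1) ∉ S1 := fun h => hwne (hSd _ h hS2.right).symm
    refine ⟨p, q', sa, sb, _, _, hp, hq', hqL', hs, hAe, hglue, ?_, ?_, ?_⟩
    · rintro x (hx | rfl) (hx' | hx')
      · exact hd x hx (hsub x hx')
      · exact hwA (hXA x hx hx' ▸ hx)
      · exact hnS hx'
      · exact hz hx'
    · rintro i hi (h | h | h)
      · exact h1 i hi (Or.inl (e1 i hi h))
      · exact h1 i hi (Or.inr (hsub _ h))
      · exact h1 i hi (Or.inr (hXi i hi h ▸ hwB))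
    · rintro i hi hiL (h | h | h)
      · exact Or.inl (e2 i hi hiL h)
      · exact Or.inl (e3 i hi hiL (hsub _ h))
      · exact Or.inr (hYi i hi hiL h)
  · obtain ⟨p', hp', rfl⟩ : ∃ i, i ≤ a ∧ v i = w := by
      rcases hw with h | h | h
      · exact h
      · exact absurd h hwA
      · exact absurd h hwB
    have hp'W : ∀ i, i ≤ a → v i ∈ W → i = p' := fun i hi h =>
      hinj _ _ (by omega) (by omega) (hXi i hi h)
    have hp'a : p' < a := by
      rcases Nat.lt_or_ge p' a with h | h
      · exact h
      · have : p' = a := by omega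
        subst this
        rcases hs with ⟨rfl, rfl⟩ | ⟨rfl, rfl⟩
        · exact absurd hsaA hwA
        · exact absurd hsbB hwB
    rcases hs with ⟨rfl, rfl⟩ | ⟨rfl, rfl⟩
    · refine ⟨p', q', _, _, _, _, hp'a, hq', hqL', Or.inl ⟨rfl, rfl⟩, hAe, hW, ?_, ?_, ?_⟩
      · rintro x (hx | rfl) hx'
        · exact hwA (hXA x hx hx' ▸ hx)
        · exact hz hx'
      · rintro i hi (h | h)
        · have h5 := e1 i hi h
          rcases h1 i hi (Or.inl h5) with h6 | h6
          · exact Or.inl h6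
          · subst h6; exact absurd hsbB (hd _ h5)
        · exact Or.inr (hp'W i hi h)
      · rintro i hi hiL (h | h)
        · exact Or.inl (e2 i hi hiL h)
        · exact Or.inr (hYi i hi hiL h)
    · refine ⟨p', q', _, _, _, _, hp'a, hq', hqL', Or.inl ⟨rfl, rfl⟩, hB, hW, ?_, ?_, ?_⟩
      · rintro x hx hx'
        exact hwB (hXB x hx hx' ▸ hx)
      · rintro i hi (h | h)
        · rcases h1 i hi (Or.inr h) with h6 | h6
          · exact Or.inl h6
          · subst h6; exact absurd h (hd _ hsaA)
        · exact Or.inr (hp'W i hi h)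
      · rintro i hi hiL (h | h)
        · exact Or.inl (e3 i hi hiL h)
        · exact Or.inr (hYi i hi hiL h)

theorem vine (hG : ∀ z : V, (G.induce {u | u ≠ z}).Connected) {v : ℕ → V} {L a b : ℕ}
    (hinj : ∀ i j, i ≤ L → j ≤ L → v i = v j → i = j)
    (hadj : ∀ i, i < L → G.Adj (v i) (v (i + 1)))
    (ha : 0 < a) (hab : a ≤ b) (hbL : b < L) : Vine G v L a b := by
  induction b, hab using Nat.le_induction with
  | base => exact vine_base hG hinj ha hbL
  | succ j hj ih => exact vine_step hG hinj hadj ha hj hbL (ih (by omega))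
end
section
variable {V : Type} {G : SimpleGraph V}

theorem posa_crossing [Finite V] {v : ℕ → V} {L c : ℕ}
    (hinj : ∀ i j, i ≤ L → j ≤ L → v i = v j → i = j)
    (hadj : ∀ i, i < L → G.Adj (v i) (v (i + 1)))
    (hc : 4 ≤ c) (hL : c ≤ L) (X Y : Finset ℕ)
    (hX : ∀ i ∈ X, i ≤ L ∧ G.Adj (v 0) (v i)) (hY : ∀ i ∈ Y, i ≤ L ∧ G.Adj (v L) (v i))
    (hsum : c + 1 ≤ X.card + Y.card) (hcr : ∃ i ∈ Y, ∃ j ∈ X, i < j) :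
    ∃ (x : V) (w : G.Walk x x), w.IsCycle ∧ c + 1 ≤ w.length := by
  classical
  have hX0 : ∀ i ∈ X, 0 < i := fun i hi => by
    rcases Nat.eq_zero_or_pos i with h | h
    · subst h; exact absurd (hX 0 hi).2 (G.loopless.irrefl _)
    · exact h
  have hYL : ∀ i ∈ Y, i < L := fun i hi => by
    rcases Nat.lt_or_ge i L with h | h
    · exact h
    · have : i = L := le_antisymm (hY i hi).1 h
      subst this; exact absurd (hY _ hi).2 (G.loopless.irrefl _)
  have hex : ∃ d, ∃ i ∈ Y, ∃ j ∈ X, i < j ∧ j - i = d := by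
    obtain ⟨i, hi, j, hj, hij⟩ := hcr
    exact ⟨_, i, hi, j, hj, hij, rfl⟩
  obtain ⟨i, hi, j, hj, hij, hd⟩ := Nat.find_spec hex
  have hmin : ∀ i' ∈ Y, ∀ j' ∈ X, i' < j' → j - i ≤ j' - i' := by
    intro i' hi' j' hj' h
    rw [hd]
    exact Nat.find_min' hex ⟨i', hi', j', hj', h, rfl⟩
  have hiL := hYL i hi
  have hjL := (hX j hj).1
  have s1 := (PS_s18.seg hinj hadj 0 i (by omega) (by omega))
  have s2 := (PS_s18.seg hinj hadj j L (by omega) (by omega)).symm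
  have s := s1.glue2 s2 (hY i hi).2.symm (by
    rintro x ⟨t, h1, h2, rfl⟩ ⟨t', h1', h2', h⟩
    have := hinj _ _ (by omega) (by omega) h
    omega)
  have hne : v 0 ≠ v j := fun h => by
    have := hinj _ _ (by omega) (by omega) h; omega
  have hcard : (({x | ∃ t, 0 ≤ t ∧ t ≤ i ∧ v t = x} ∪ {x | ∃ t, j ≤ t ∧ t ≤ L ∧ v t = x}) ∪
      {v j, v 0} : Set V).ncard = i + 1 + (L + 1 - j) := by
    have : (({x | ∃ t, 0 ≤ t ∧ t ≤ i ∧ v t = x} ∪ {x | ∃ t, j ≤ t ∧ t ≤ L ∧ v t = x}) ∪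
      {v j, v 0} : Set V) = v '' ((Finset.Icc 0 i ∪ Finset.Icc j L : Finset ℕ) : Set ℕ) := by
      ext x
      simp only [Set.mem_union, Set.mem_insert_iff, Set.mem_singleton_iff, Set.mem_image,
        Finset.coe_union, Finset.coe_Icc, Set.mem_Icc]
      constructor
      · rintro ((⟨t, h1, h2, rfl⟩ | ⟨t, h1, h2, rfl⟩) | rfl | rfl)
        · exact ⟨t, Or.inl ⟨h1, h2⟩, rfl⟩
        · exact ⟨t, Or.inr ⟨h1, h2⟩, rfl⟩
        · exact ⟨j, Or.inr ⟨le_rfl, hjL⟩, rfl⟩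
        · exact ⟨0, Or.inl ⟨le_rfl, by omega⟩, rfl⟩
      · rintro ⟨t, ⟨h1, h2⟩ | ⟨h1, h2⟩, rfl⟩
        · exact Or.inl (Or.inl ⟨t, h1, h2, rfl⟩)
        · exact Or.inl (Or.inr ⟨t, h1, h2, rfl⟩)
    rw [this, Set.InjOn.ncard_image, Set.ncard_coe_finset, Finset.card_union_of_disjoint]
    · simp
    · rw [Finset.disjoint_left]
      intro t ht ht'
      simp only [Finset.mem_Icc] at ht ht'
      omega
    · intro t ht t' ht' h
      simp only [Finset.coe_union, Finset.coe_Icc, Set.mem_union, Set.mem_Icc] at ht ht'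
      exact hinj _ _ (by omega) (by omega) h
  have hlen : c + 1 ≤ i + 1 + (L + 1 - j) := by
    by_cases hj1 : j = i + 1
    · omega
    have hsub : X ∪ Y.image (· + 1) ⊆ Finset.Icc 1 (i + 1) ∪ Finset.Icc j L := by
      intro t ht
      simp only [Finset.mem_union, Finset.mem_image, Finset.mem_Icc] at ht ⊢
      rcases ht with ht | ⟨u, hu, rfl⟩
      · have := hX0 t ht
        have := (hX t ht).1
        by_cases h : i < t
        · have := hmin i hi t ht h; omega
        · omega
      · have := hYL u hu
        by_cases h : u < j
        · have := hmin u hu j hj h; omega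
        · omega
    have hdis : Disjoint X (Y.image (· + 1)) := by
      rw [Finset.disjoint_left]
      intro t ht ht'
      simp only [Finset.mem_image] at ht'
      obtain ⟨u, hu, rfl⟩ := ht'
      have := hmin u hu _ ht (by omega)
      omega
    have h1 := Finset.card_le_card hsub
    rw [Finset.card_union_of_disjoint hdis, Finset.card_image_of_injective _ (add_left_injective 1)] at h1
    have h2 := Finset.card_union_le (Finset.Icc 1 (i + 1)) (Finset.Icc j L)
    simp only [Nat.card_Icc] at h2
    omega
  obtain ⟨x, w, hw, hwl⟩ := s.close (PS_s18.edge (hX j hj).2.symm) hne (by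
    rintro x - (rfl | rfl) <;> simp) (by rw [hcard]; omega)
  exact ⟨x, w, hw, by rw [hwl, hcard]; exact hlen⟩

theorem posa_noncrossing [Finite V] (hG : ∀ z : V, (G.induce {u | u ≠ z}).Connected)
    {v : ℕ → V} {L c : ℕ}
    (hinj : ∀ i j, i ≤ L → j ≤ L → v i = v j → i = j)
    (hadj : ∀ i, i < L → G.Adj (v i) (v (i + 1)))
    (hc : 4 ≤ c) (X Y : Finset ℕ)
    (hX : ∀ i ∈ X, i ≤ L ∧ G.Adj (v 0) (v i)) (hY : ∀ i ∈ Y, i ≤ L ∧ G.Adj (v L) (v i))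
    (hsum : c + 1 ≤ X.card + Y.card) (hXn : X.Nonempty) (hYn : Y.Nonempty)
    (hcr : ∀ i ∈ Y, ∀ j ∈ X, j ≤ i) :
    ∃ (x : V) (w : G.Walk x x), w.IsCycle ∧ c + 1 ≤ w.length := by
  classical
  have hX0 : ∀ i ∈ X, 0 < i := fun i hi => by
    rcases Nat.eq_zero_or_pos i with h | h
    · subst h; exact absurd (hX 0 hi).2 (G.loopless.irrefl _)
    · exact h
  have hYL : ∀ i ∈ Y, i < L := fun i hi => by
    rcases Nat.lt_or_ge i L with h | h
    · exact h
    · have : i = L := le_antisymm (hY i hi).1 h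
      subst this; exact absurd (hY _ hi).2 (G.loopless.irrefl _)
  obtain ⟨a, haX, hamax⟩ : ∃ a ∈ X, ∀ i ∈ X, i ≤ a := ⟨X.max' hXn, X.max'_mem hXn, fun i hi => X.le_max' i hi⟩
  obtain ⟨b, hbY, hbmin⟩ : ∃ b ∈ Y, ∀ i ∈ Y, b ≤ i := ⟨Y.min' hYn, Y.min'_mem hYn, fun i hi => Y.min'_le i hi⟩
  have ha0 := hX0 a haX
  have hbL := hYL b hbY
  have hab := hcr b hbY a haX
  obtain ⟨p, q, sa, sb, RA, RB, hp, hq, hqL, hs, hA, hB, hd, h1, h2⟩ := vine hG hinj hadj ha0 hab hbL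
  obtain ⟨a', ha'X, ha'p, ha'min⟩ : ∃ a' ∈ X, p < a' ∧ ∀ i ∈ X, p < i → a' ≤ i := by
    have hn : (X.filter (p < ·)).Nonempty := ⟨a, by simp [haX, hp]⟩
    have := Finset.min'_mem _ hn
    rw [Finset.mem_filter] at this
    exact ⟨_, this.1, this.2, fun i hi hpi => Finset.min'_le _ _ (by simp [hi, hpi])⟩
  obtain ⟨b', hb'Y, hb'q, hb'max⟩ : ∃ b' ∈ Y, b' < q ∧ ∀ i ∈ Y, i < q → i ≤ b' := by
    have hn : (Y.filter (· < q)).Nonempty := ⟨b, by simp [hbY, hq]⟩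
    have := Finset.max'_mem _ hn
    rw [Finset.mem_filter] at this
    exact ⟨_, this.1, this.2, fun i hi hpi => Finset.le_max' _ _ (by simp [hi, hpi])⟩
  have ha'a := hamax a' ha'X
  have hbb' := hbmin b' hb'Y
  have pa : PS_s18 G (v a) (v p) ({x | ∃ t, a' ≤ t ∧ t ≤ a ∧ v t = x} ∪ {x | ∃ t, 0 ≤ t ∧ t ≤ p ∧ v t = x}) :=
    (PS_s18.seg hinj hadj a' a ha'a (by omega)).symm.glue2 (PS_s18.seg hinj hadj 0 p (by omega) (by omega))
      (hX a' ha'X).2.symm (by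
        rintro x ⟨t, h1, h2, rfl⟩ ⟨t', h1', h2', h⟩
        have := hinj _ _ (by omega) (by omega) h
        omega)
  have pb : PS_s18 G (v q) (v b) ({x | ∃ t, q ≤ t ∧ t ≤ L ∧ v t = x} ∪ {x | ∃ t, b ≤ t ∧ t ≤ b' ∧ v t = x}) :=
    (PS_s18.seg hinj hadj q L (by omega) (by omega)).glue2 (PS_s18.seg hinj hadj b b' hbb' (by omega)).symm
      (hY b' hb'Y).2 (by
        rintro x ⟨t, h1, h2, rfl⟩ ⟨t', h1', h2', h⟩
        have := hinj _ _ (by omega) (by omega) h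
        omega)
  set PA : Set V := ({x | ∃ t, a' ≤ t ∧ t ≤ a ∧ v t = x} ∪ {x | ∃ t, 0 ≤ t ∧ t ≤ p ∧ v t = x}) with hPA
  set PB : Set V := ({x | ∃ t, q ≤ t ∧ t ≤ L ∧ v t = x} ∪ {x | ∃ t, b ≤ t ∧ t ≤ b' ∧ v t = x}) with hPB
  have mA : ∀ x ∈ PA, ∃ t ≤ a, v t = x := by
    rintro x (⟨t, h1, h2, h⟩ | ⟨t, h1, h2, h⟩)
    · exact ⟨t, h2, h⟩
    · exact ⟨t, by omega, h⟩
  have mB : ∀ x ∈ PB, ∃ t, b ≤ t ∧ t ≤ L ∧ v t = x := by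
    rintro x (⟨t, h1, h2, h⟩ | ⟨t, h1, h2, h⟩)
    · exact ⟨t, by omega, by omega, h⟩
    · exact ⟨t, by omega, by omega, h⟩
  have hsA := hA.left
  have hsB := hB.left
  have hbA := hA.right
  have hqB := hB.right
  have pa' : PS_s18 G sa sb PA := by
    rcases hs with ⟨rfl, rfl⟩ | ⟨rfl, rfl⟩
    · exact pa
    · exact pa.symm
  have hends : ∀ x, x ∈ PA → (x ∈ RA ∨ x ∈ RB) → x = sa ∨ x = sb := by
    intro x hx hx'
    obtain ⟨t, ht, rfl⟩ := mA x hx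
    rcases h1 t ht hx' with rfl | rfl <;> tauto
  have hendsB : ∀ x, x ∈ PB → (x ∈ RA ∨ x ∈ RB) → x = v b ∨ x = v q := by
    intro x hx hx'
    obtain ⟨t, ht, ht', rfl⟩ := mB x hx
    rcases h2 t ht ht' hx' with rfl | rfl <;> tauto
  have s1 : PS_s18 G (v b) sb (RA ∪ PA) := hA.symm.glue pa' (by
    intro x hx hx'
    rcases hends x hx' (Or.inl hx) with h | h
    · exact h
    · subst h; exact absurd hsB (hd _ hx))
  have s2 : PS_s18 G (v b) (v q) ((RA ∪ PA) ∪ RB) := s1.glue hB (by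
    rintro x (hx | hx) hx'
    · exact absurd hx' (hd _ hx)
    · rcases hends x hx (Or.inr hx') with h | h
      · subst h; exact absurd hx' (hd _ hsA)
      · exact h)
  have hne : v b ≠ v q := fun h => by
    have := hinj _ _ (by omega) (by omega) h; omega
  have hcard : c + 1 ≤ (((RA ∪ PA) ∪ RB) ∪ PB : Set V).ncard := by
    have hsub : v '' ((X ∪ (Y ∪ {0, L}) : Finset ℕ) : Set ℕ) ⊆ (((RA ∪ PA) ∪ RB) ∪ PB : Set V) := by
      rintro x ⟨t, ht, rfl⟩
      simp only [Finset.coe_union, Set.mem_union, Finset.mem_coe, Finset.mem_insert,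
        Finset.mem_singleton] at ht
      have key1 : t ∈ X → v t ∈ PA := by
        intro ht
        by_cases h : p < t
        · exact Or.inl ⟨t, ha'min t ht h, hamax t ht, rfl⟩
        · exact Or.inr ⟨t, by omega, by omega, rfl⟩
      have key2 : t ∈ Y → v t ∈ PB := by
        intro ht
        by_cases h : t < q
        · exact Or.inr ⟨t, hbmin t ht, hb'max t ht h, rfl⟩
        · exact Or.inl ⟨t, by omega, (hY t ht).1, rfl⟩
      rcases ht with ht | ht | ht | ht
      · exact Or.inl (Or.inl (Or.inr (key1 ht)))
      · exact Or.inr (key2 ht)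
      · subst ht
        exact Or.inl (Or.inl (Or.inr (Or.inr ⟨0, le_rfl, by omega, rfl⟩)))
      · subst ht
        exact Or.inr (Or.inl ⟨t, by omega, le_rfl, rfl⟩)
    have h3 := Set.ncard_le_ncard hsub (Set.toFinite _)
    have hle : ∀ t ∈ X ∪ (Y ∪ {0, L}), t ≤ L := by
      intro t ht
      simp only [Finset.mem_union, Finset.mem_insert, Finset.mem_singleton] at ht
      rcases ht with ht | ht | ht | ht
      · exact (hX t ht).1
      · exact (hY t ht).1
      · omega
      · omega
    rw [Set.InjOn.ncard_image (by
      intro t ht t' ht' h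
      exact hinj _ _ (hle t ht) (hle t' ht') h), Set.ncard_coe_finset] at h3
    have h4 : Disjoint Y {0, L} := by
      rw [Finset.disjoint_left]
      intro t ht ht'
      simp only [Finset.mem_insert, Finset.mem_singleton] at ht'
      have := hYL t ht
      have := hbmin t ht
      omega
    have h5 := Finset.card_union_add_card_inter X (Y ∪ {0, L})
    rw [Finset.card_union_of_disjoint h4, Finset.card_pair (by omega)] at h5
    have h6 : X ∩ (Y ∪ {0, L}) ⊆ {a} := by
      intro t ht
      simp only [Finset.mem_inter, Finset.mem_union, Finset.mem_insert, Finset.mem_singleton] at ht ⊢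
      obtain ⟨h7, h8⟩ := ht
      have := hX0 t h7
      have := hamax t h7
      rcases h8 with h8 | h8 | h8
      · have := hbmin t h8; omega
      · omega
      · omega
    have h7 := Finset.card_le_card h6
    rw [Finset.card_singleton] at h7
    omega
  obtain ⟨x, w, hw, hwl⟩ := s2.close pb hne (by
    rintro x ((hx | hx) | hx) hx'
    · exact hendsB x hx' (Or.inl hx)
    · obtain ⟨t, ht, rfl⟩ := mA x hx
      obtain ⟨t', ht1, ht2, h⟩ := mB _ hx'
      have := hinj _ _ (by omega) (by omega) h
      have : t = b := by omega
      subst this; exact Or.inl rfl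
    · exact hendsB x hx' (Or.inr hx)) (by omega)
  exact ⟨x, w, hw, by omega⟩

theorem posa [Finite V] (hG : ∀ z : V, (G.induce {u | u ≠ z}).Connected)
    {x y : V} (p : G.Walk x y) (hp : p.IsPath) {c : ℕ} (hc : 4 ≤ c) (hL : c ≤ p.length)
    (A B : Finset V) (hA : ∀ u ∈ A, G.Adj x u ∧ u ∈ p.support) (hB : ∀ u ∈ B, G.Adj y u ∧ u ∈ p.support)
    (hA0 : A.Nonempty) (hB0 : B.Nonempty) (hsum : c + 1 ≤ A.card + B.card) :
    ∃ (x : V) (w : G.Walk x x), w.IsCycle ∧ c + 1 ≤ w.length := by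
  classical
  have hinj : ∀ i j, i ≤ p.length → j ≤ p.length → p.getVert i = p.getVert j → i = j :=
    fun i j hi hj h => hp.getVert_injOn hi hj h
  have hadj : ∀ i, i < p.length → G.Adj (p.getVert i) (p.getVert (i + 1)) :=
    fun i hi => p.adj_getVert_succ hi
  let X := (Finset.range (p.length + 1)).filter (fun i => p.getVert i ∈ A)
  let Y := (Finset.range (p.length + 1)).filter (fun i => p.getVert i ∈ B)
  have card : ∀ C : Finset V, (∀ u ∈ C, u ∈ p.support) →
      C.card ≤ ((Finset.range (p.length + 1)).filter (fun i => p.getVert i ∈ C)).card := by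
    intro C hC
    have : C ⊆ ((Finset.range (p.length + 1)).filter (fun i => p.getVert i ∈ C)).image p.getVert := by
      intro u hu
      obtain ⟨i, h1, h2⟩ := Walk.mem_support_iff_exists_getVert.1 (hC u hu)
      simp only [Finset.mem_image, Finset.mem_filter, Finset.mem_range]
      exact ⟨i, ⟨by omega, by rw [h1]; exact hu⟩, h1⟩
    exact (Finset.card_le_card this).trans Finset.card_image_le
  have cX : A.card ≤ X.card := card A (fun u hu => (hA u hu).2)
  have cY : B.card ≤ Y.card := card B (fun u hu => (hB u hu).2)
  have a0 := hA0.card_pos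
  have b0 := hB0.card_pos
  have hX : ∀ i ∈ X, i ≤ p.length ∧ G.Adj (p.getVert 0) (p.getVert i) := by
    intro i hi
    simp only [X, Finset.mem_filter, Finset.mem_range] at hi
    refine ⟨by omega, ?_⟩
    rw [Walk.getVert_zero]
    exact (hA _ hi.2).1
  have hY : ∀ i ∈ Y, i ≤ p.length ∧ G.Adj (p.getVert p.length) (p.getVert i) := by
    intro i hi
    simp only [Y, Finset.mem_filter, Finset.mem_range] at hi
    refine ⟨by omega, ?_⟩
    rw [Walk.getVert_length]
    exact (hB _ hi.2).1
  have hXY : c + 1 ≤ X.card + Y.card := by omega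
  by_cases hcr : ∃ i ∈ Y, ∃ j ∈ X, i < j
  · exact posa_crossing hinj hadj hc hL X Y hX hY hXY hcr
  · push Not at hcr
    exact posa_noncrossing hG hinj hadj hc X Y hX hY hXY
      (Finset.card_pos.1 (by omega)) (Finset.card_pos.1 (by omega)) hcr
end
section
variable {V : Type} {G : SimpleGraph V}

theorem longest_path [Finite V] (Q : V → V → Prop) {x0 y0 : V} (hQ : Q x0 y0) (p0 : G.Walk x0 y0)
    (hp0 : p0.IsPath) : ∃ (x y : V) (p : G.Walk x y), p.IsPath ∧ Q x y ∧
      ∀ (x' y' : V) (p' : G.Walk x' y'), p'.IsPath → Q x' y' → p'.length ≤ p.length := by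
  classical
  have := Fintype.ofFinite V
  let P : ℕ → Prop := fun n => ∃ (x y : V) (p : G.Walk x y), p.IsPath ∧ Q x y ∧ p.length = n
  have hb : ∀ n, P n → n ≤ Fintype.card V := by
    rintro n ⟨x, y, p, hp, -, rfl⟩
    exact hp.length_lt.le
  have h0 : P p0.length := ⟨x0, y0, p0, hp0, hQ, rfl⟩
  obtain ⟨x, y, p, hp, hq, hl⟩ := Nat.findGreatest_spec (hb _ h0) h0
  refine ⟨x, y, p, hp, hq, ?_⟩
  intro x' y' p' hp' hq'
  have h1 : P p'.length := ⟨x', y', p', hp', hq', rfl⟩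
  have := Nat.le_findGreatest (hb _ h1) h1
  omega

theorem cycle_of_path {x y : V} (p : G.Walk x y) (hp : p.IsPath) (h : G.Adj x y)
    (hl : 2 ≤ p.length) : ∃ (x : V) (w : G.Walk x x), w.IsCycle ∧ w.length = p.length + 1 := by
  refine ⟨y, Walk.cons h.symm p, ?_, by simp⟩
  rw [Walk.cons_isCycle_iff]
  refine ⟨hp, fun he => ?_⟩
  rw [Sym2.eq_swap] at he
  have := hp.length_eq_one_of_mem_edges he
  omega

theorem allAdj [Finite V] (hG : ∀ z : V, (G.induce {u | u ≠ z}).Connected) {c : ℕ} (hc : 4 ≤ c)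
    (hno : ∀ (x : V) (w : G.Walk x x), w.IsCycle → w.length ≤ c)
    (hmax : ∀ x y : V, x ≠ y → ¬ G.Adj x y → ∃ p : G.Walk x y, p.IsPath ∧ c ≤ p.length)
    [DecidableRel G.Adj]
    (A B : Finset V) (α β : ℕ) (hA : ∀ x ∈ A, α ≤ (A.filter (G.Adj x)).card)
    (hB : ∀ x ∈ B, β ≤ (B.filter (G.Adj x)).card) (hα : 1 ≤ α) (hβ : 1 ≤ β)
    (hαβ : c + 1 ≤ α + β) (x y : V) (hx : x ∈ A) (hy : y ∈ B) (hxy : x ≠ y) : G.Adj x y := by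
  by_contra hn
  obtain ⟨p0, hp0, hl0⟩ := hmax x y hxy hn
  obtain ⟨x1, y1, p, hp, ⟨hx1, hy1, hxy1, hn1⟩, hlong⟩ := longest_path
    (fun x y => x ∈ A ∧ y ∈ B ∧ x ≠ y ∧ ¬ G.Adj x y) ⟨hx, hy, hxy, hn⟩ p0 hp0
  have hl : c ≤ p.length := hl0.trans (hlong x y p0 hp0 ⟨hx, hy, hxy, hn⟩)
  have h1 := hA x1 hx1
  have h2 := hB y1 hy1
  obtain ⟨z, w, hw, hwl⟩ := posa hG p hp hc hl (A.filter (G.Adj x1)) (B.filter (G.Adj y1))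
    (by
      intro u hu
      rw [Finset.mem_filter] at hu
      refine ⟨hu.2, ?_⟩
      by_contra hus
      have hp' : (Walk.cons hu.2.symm p).IsPath := hp.cons hus
      by_cases hadj : G.Adj u y1
      · obtain ⟨z, w, hw, hwl⟩ := cycle_of_path _ hp' hadj (by simp; omega)
        have := hno z w hw
        rw [Walk.length_cons] at hwl
        omega
      · have := hlong u y1 _ hp' ⟨hu.1, hy1, fun h => hus (h ▸ p.end_mem_support), hadj⟩
        rw [Walk.length_cons] at this
        omega)
    (by
      intro u hu
      rw [Finset.mem_filter] at hu
      refine ⟨hu.2, ?_⟩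
      by_contra hus
      have hp' : (p.concat hu.2).IsPath := hp.concat hus hu.2
      by_cases hadj : G.Adj x1 u
      · obtain ⟨z, w, hw, hwl⟩ := cycle_of_path _ hp' hadj (by simp; omega)
        have := hno z w hw
        rw [Walk.length_concat] at hwl
        omega
      · have := hlong x1 u _ hp' ⟨hx1, hu.1, fun h => hus (h ▸ p.start_mem_support), hadj⟩
        rw [Walk.length_concat] at this
        omega)
    (Finset.card_pos.1 (by omega)) (Finset.card_pos.1 (by omega)) (by omega)
  have := hno z w hw
  omega

theorem path_of_cycle_edge {H : SimpleGraph V} {x y : V} (w : H.Walk x x) (hw : w.IsCycle)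
    (he : s(x, y) ∈ w.edges) (hGH : ∀ a b, H.Adj a b → s(a, b) ≠ s(x, y) → G.Adj a b) :
    ∃ p : G.Walk x y, p.IsPath ∧ p.length + 1 = w.length := by
  have main : ∀ w : H.Walk x x, w.IsCycle → w.snd = y →
      ∃ p : G.Walk x y, p.IsPath ∧ p.length + 1 = w.length := by
    intro w hw hs
    cases w with
    | nil => simp at hw
    | cons h q =>
      rw [Walk.snd_cons] at hs
      subst hs
      rw [Walk.cons_isCycle_iff] at hw
      have hq : ∀ e ∈ q.edges, e ∈ G.edgeSet := by
        intro e
        induction e with | _ a b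
        intro he
        rw [mem_edgeSet]
        exact hGH a b (q.adj_of_mem_edges he) (fun h => hw.2 (h ▸ he))
      exact ⟨(q.transfer G hq).reverse, (hw.1.transfer hq).reverse, by simp⟩
  have hadj : y ∈ w.toSubgraph.neighborSet x := by
    rw [Subgraph.mem_neighborSet, ← Subgraph.mem_edgeSet, Walk.mem_edges_toSubgraph]
    exact he
  rw [hw.neighborSet_toSubgraph_endpoint] at hadj
  rcases hadj with h | h
  · exact main w hw h.symm
  · obtain ⟨p, hp, hl⟩ := main w.reverse hw.reverse (by rw [Walk.snd_reverse]; exact h.symm)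
    exact ⟨p, hp, by simpa using hl⟩

theorem hmax_of_maximal {c : ℕ}
    (h : Maximal (fun G : SimpleGraph V => ∀ (x : V) (w : G.Walk x x), w.IsCycle → w.length ≤ c) G) :
    ∀ x y : V, x ≠ y → ¬ G.Adj x y → ∃ p : G.Walk x y, p.IsPath ∧ c ≤ p.length := by
  classical
  intro x y hxy hn
  by_contra hcon
  push Not at hcon
  apply hn
  refine h.2 (y := G ⊔ edge x y) ?_ le_sup_left (by simp [edge_adj, hxy])
  intro z w hw
  have hGH : ∀ a b, (G ⊔ edge x y).Adj a b → s(a, b) ≠ s(x, y) → G.Adj a b := by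
    intro a b hab hne
    rw [sup_adj, edge_adj] at hab
    rcases hab with hab | hab
    · exact hab
    · exfalso; apply hne; rw [Sym2.eq_iff]; exact hab.1
  by_cases he : s(x, y) ∈ w.edges
  · have hx : x ∈ w.support := w.fst_mem_support_of_mem_edges he
    obtain ⟨p, hp, hl⟩ := path_of_cycle_edge (G := G) (w.rotate x hx) (hw.rotate hx)
      (by rw [(w.rotate_edges x hx).perm.mem_iff]; exact he) hGH
    have := hcon p hp
    rw [Walk.length_rotate] at hl
    omega
  · have hq : ∀ e ∈ w.edges, e ∈ G.edgeSet := by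
      intro e
      induction e with | _ a b
      intro h
      rw [mem_edgeSet]
      exact hGH a b (w.adj_of_mem_edges h) (fun h' => he (h' ▸ h))
    have := h.1 z (w.transfer G hq) (hw.transfer hq)
    simpa using this

theorem clique_cycle [Finite V] (S : Finset V) (hS : ∀ x ∈ S, ∀ y ∈ S, x ≠ y → G.Adj x y)
    (h3 : 3 ≤ S.card) : ∃ (x : V) (w : G.Walk x x), w.IsCycle ∧ w.length = S.card := by
  classical
  have main : ∀ S : Finset V, (∀ x ∈ S, ∀ y ∈ S, x ≠ y → G.Adj x y) → S.Nonempty →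
      ∃ x y, PS_s18 G x y (S : Set V) := by
    intro S
    induction S using Finset.induction_on with
    | empty => intro _ h; simp at h
    | insert a S ha ih =>
      intro h _
      by_cases hS : S.Nonempty
      · obtain ⟨x, y, hp⟩ := ih (fun x hx y hy => h x (by simp [hx]) y (by simp [hy])) hS
        have hy : y ∈ S := hp.right
        refine ⟨x, a, (hp.extend (h y (by simp [hy]) a (by simp) (fun e => ha (e ▸ hy))) (by simpa using ha)).congr ?_⟩
        intro t; simp
      · rw [Finset.not_nonempty_iff_eq_empty] at hS
        subst hS
        exact ⟨a, a, (PS_s18.refl a).congr (by simp)⟩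
  obtain ⟨x, y, hp⟩ := main S hS (Finset.card_pos.1 (by omega))
  have hx : x ∈ S := hp.left
  have hy : y ∈ S := hp.right
  have hU : (S : Set V) ∪ {y, x} = S := by
    rw [Set.union_eq_left]
    rintro t (rfl | rfl) <;> simpa
  by_cases hxy : x = y
  · subst hxy
    exfalso
    obtain ⟨p, hp, hps⟩ := hp
    have := (Walk.isPath_iff_nil.1 hp).eq_nil
    subst this
    have : S = {x} := by ext t; have := hps t; simp at this; simp [this]
    rw [this] at h3
    simp at h3
  · have := hp.close (PS_s18.edge (hS y hy x hx (Ne.symm hxy))) hxy (by rintro t - (rfl | rfl) <;> simp)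
      (by rw [hU, Set.ncard_coe_finset]; exact h3)
    rw [hU, Set.ncard_coe_finset] at this
    exact this
end
section

theorem choose_second_diff (M r : ℕ) : 2 * (M + 1).choose r ≤ M.choose r + (M + 2).choose r := by
  cases r with
  | zero => simp
  | succ r =>
    have h1 := Nat.choose_succ_succ' M r
    have h2 := Nat.choose_succ_succ' (M + 1) r
    have h3 : M.choose r ≤ (M + 1).choose r := Nat.choose_le_succ M r
    show _ ≤ _ + (M + 1 + 1).choose (r + 1)
    omega

theorem quasi_convex (F : ℕ → ℕ) (k t : ℕ)
    (hF : ∀ j, k ≤ j → j + 2 ≤ t → 2 * F (j + 1) ≤ F j + F (j + 2)) (j : ℕ) (hkj : k ≤ j)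
    (hjt : j ≤ t) : F j ≤ max (F k) (F t) := by
  have hS : ∀ j, k ≤ j → j < t → F j ≤ F k ∨ F j ≤ F (j + 1) := by
    intro j hj
    induction j, hj using Nat.le_induction with
    | base => intro _; left; exact le_rfl
    | succ j hj ih =>
      intro hjt
      have := ih (by omega)
      have := hF j hj (by omega)
      rw [show j + 1 + 1 = j + 2 from rfl]
      omega
  by_cases hjk : F j ≤ F k
  · exact le_max_of_le_left hjk
  · apply le_max_of_le_right
    have hmono : ∀ i, j ≤ i → i ≤ t → F j ≤ F i := by
      intro i hi
      induction i, hi using Nat.le_induction with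
      | base => intro _; exact le_rfl
      | succ i hi ih =>
        intro hit
        have h1 := ih (by omega)
        have h2 := hS i (by omega) (by omega)
        omega
    exact hmono t hjt le_rfl

theorem f_quasi (n c s k t j : ℕ) (hn : c + 1 ≤ n) (ht : 2 * t ≤ c) (hkj : k ≤ j) (hjt : j ≤ t) :
    Nat.choose (c + 1 - j) s + (n + j - c - 1) * Nat.choose j (s - 1) ≤
    max (Nat.choose (c + 1 - k) s + (n + k - c - 1) * Nat.choose k (s - 1))
      (Nat.choose (c + 1 - t) s + (n + t - c - 1) * Nat.choose t (s - 1)) := by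
  refine quasi_convex (fun j => Nat.choose (c + 1 - j) s + (n + j - c - 1) * Nat.choose j (s - 1)) k t
    ?_ j hkj hjt
  intro j _ hj
  obtain ⟨N, rfl⟩ : ∃ N, n = c + 1 + N := ⟨n - (c + 1), by omega⟩
  obtain ⟨M, rfl⟩ : ∃ M, c = M + j + 1 := ⟨c - (j + 1), by omega⟩
  rw [show M + j + 1 + 1 - (j + 1) = M + 1 by omega, show M + j + 1 + 1 - j = M + 2 by omega,
    show M + j + 1 + 1 - (j + 2) = M by omega,
    show M + j + 1 + 1 + N + (j + 1) - (M + j + 1) - 1 = N + j + 1 by omega,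
    show M + j + 1 + 1 + N + j - (M + j + 1) - 1 = N + j by omega,
    show M + j + 1 + 1 + N + (j + 2) - (M + j + 1) - 1 = N + j + 2 by omega]
  have h1 := choose_second_diff M s
  have h2 := choose_second_diff j (s - 1)
  have h3 : (j + 1).choose (s - 1) ≤ (j + 2).choose (s - 1) := Nat.choose_le_succ _ _
  have h4 := Nat.mul_le_mul_left (N + j) h2
  nlinarith

variable {V : Type} {G : SimpleGraph V}

/-- Number of `s`-cliques inside `A`. -/
noncomputable def cliqIn (G : SimpleGraph V) (s : ℕ) (A : Finset V) : ℕ :=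
  Nat.card {S : Finset V // S ⊆ A ∧ G.IsNClique s S}

theorem cliqIn_le [Finite V] (s : ℕ) (A : Finset V) : cliqIn G s A ≤ A.card.choose s := by
  classical
  have := Fintype.ofFinite V
  rw [← Finset.card_powersetCard, cliqIn, Nat.card_eq_fintype_card, Fintype.card_subtype]
  apply Finset.card_le_card
  intro S hS
  rw [Finset.mem_filter] at hS
  rw [Finset.mem_powersetCard]
  exact ⟨hS.2.1, hS.2.2.card_eq⟩

theorem cliqIn_step [Finite V] [DecidableEq V] [DecidableRel G.Adj] (s : ℕ) (A : Finset V) (u : V) (d : ℕ)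
    (hd : (A.filter (G.Adj u)).card ≤ d) :
    cliqIn G s A ≤ cliqIn G s (A.erase u) + d.choose (s - 1) := by
  classical
  have := Fintype.ofFinite V
  unfold cliqIn
  simp only [Nat.card_eq_fintype_card, Fintype.card_subtype]
  have hsub : (Finset.univ.filter fun S : Finset V => S ⊆ A ∧ G.IsNClique s S) ⊆
      (Finset.univ.filter fun S : Finset V => S ⊆ A.erase u ∧ G.IsNClique s S) ∪
      ((A.filter (G.Adj u)).powersetCard (s - 1)).image (fun T => insert u T) := by
    intro S hS
    rw [Finset.mem_filter] at hS
    obtain ⟨-, hSA, hcl⟩ := hS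
    rw [Finset.mem_union]
    by_cases hu : u ∈ S
    · right
      rw [Finset.mem_image]
      refine ⟨S.erase u, ?_, Finset.insert_erase hu⟩
      rw [Finset.mem_powersetCard, Finset.card_erase_of_mem hu, hcl.card_eq]
      refine ⟨?_, rfl⟩
      intro x hx
      rw [Finset.mem_erase] at hx
      rw [Finset.mem_filter]
      exact ⟨hSA hx.2, hcl.isClique hu hx.2 (Ne.symm hx.1)⟩
    · left
      rw [Finset.mem_filter]
      exact ⟨Finset.mem_univ _, Finset.subset_erase.2 ⟨hSA, hu⟩, hcl⟩
  refine (Finset.card_le_card hsub).trans ((Finset.card_union_le _ _).trans ?_)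
  apply Nat.add_le_add_left
  refine Finset.card_image_le.trans ?_
  rw [Finset.card_powersetCard]
  exact Nat.choose_le_choose _ hd

theorem cliqIn_bound [Finite V] [DecidableEq V] [DecidableRel G.Adj] (s : ℕ)
    (H : Finset V) (r d : ℕ)
    (h : ∀ A : Finset V, H ⊆ A → r < A.card → ∃ u ∈ A, u ∉ H ∧ (A.filter (G.Adj u)).card ≤ d) :
    ∀ (m : ℕ) (A : Finset V), H ⊆ A → A.card = r + m →
      cliqIn G s A ≤ r.choose s + m * d.choose (s - 1) := by
  intro m
  induction m with
  | zero =>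
    intro A _ hA
    simpa [hA] using cliqIn_le (G := G) s A
  | succ m ih =>
    intro A hHA hA
    obtain ⟨u, huA, huH, hu⟩ := h A hHA (by omega)
    have h1 := cliqIn_step s A u d hu
    have h2 := ih (A.erase u) (Finset.subset_erase.2 ⟨hHA, huH⟩)
      (by rw [Finset.card_erase_of_mem huA]; omega)
    rw [Nat.succ_mul]
    omega

/-- The `d`-core. -/
theorem exists_core [Finite V] [DecidableRel G.Adj] (d : ℕ) : ∃ H : Finset V,
    (∀ u ∈ H, d ≤ (H.filter (G.Adj u)).card) ∧
    ∀ S : Finset V, (∀ u ∈ S, d ≤ (S.filter (G.Adj u)).card) → S ⊆ H := by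
  classical
  have := Fintype.ofFinite V
  have hmem : ∀ S : Finset V, (∀ u ∈ S, d ≤ (S.filter (G.Adj u)).card) →
      S ⊆ Finset.univ.filter (fun v => ∃ S : Finset V, v ∈ S ∧ ∀ u ∈ S, d ≤ (S.filter (G.Adj u)).card) := by
    intro S hS v hv
    rw [Finset.mem_filter]
    exact ⟨Finset.mem_univ _, S, hv, hS⟩
  refine ⟨_, ?_, hmem⟩
  intro u hu
  obtain ⟨-, S, huS, hS⟩ := Finset.mem_filter.1 hu
  exact (hS u huS).trans (Finset.card_le_card (Finset.filter_subset_filter _ (hmem S hS)))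

theorem core_main [Fintype V] [DecidableEq V] [DecidableRel G.Adj] (n c k s : ℕ) (h1 : c + 1 ≤ n) (h2 : 4 ≤ c) (h3 : 2 ≤ s) 
    (hV : Fintype.card V = n) (hG : ∀ z : V, (G.induce {u | u ≠ z}).Connected)
    (hno : ∀ (x : V) (w : G.Walk x x), w.IsCycle → w.length ≤ c)
    (hmax : ∀ x y : V, x ≠ y → ¬ G.Adj x y → ∃ p : G.Walk x y, p.IsPath ∧ c ≤ p.length)
    (hdeg : ∀ v, k ≤ (Finset.univ.filter (G.Adj v)).card) :
    cliqIn G s Finset.univ ≤ max (Nat.choose (c + 1 - k) s + (n + k - c - 1) * Nat.choose k (s - 1))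
      (Nat.choose (c + 1 - c / 2) s + (n + c / 2 - c - 1) * Nat.choose (c / 2) (s - 1)) := by
  set t := c / 2 with ht
  obtain ⟨H, hH, hHmax⟩ := exists_core (G := G) (t + 1)
  have hlow : ∀ (d : ℕ) (H A : Finset V), (∀ u ∈ H, d + 1 ≤ (H.filter (G.Adj u)).card) →
      (∀ S : Finset V, (∀ u ∈ S, d + 1 ≤ (S.filter (G.Adj u)).card) → S ⊆ H) →
      H ⊆ A → H.card < A.card → ∃ u ∈ A, u ∉ H ∧ (A.filter (G.Adj u)).card ≤ d := by
    intro d H A hH hHmax hHA hc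
    by_contra hcon
    push Not at hcon
    have : A ⊆ H := hHmax A (by
      intro u hu
      by_cases huH : u ∈ H
      · exact (hH u huH).trans (Finset.card_le_card (Finset.filter_subset_filter _ hHA))
      · exact hcon u hu huH)
    have := Finset.card_le_card this
    omega
  rcases H.eq_empty_or_nonempty with hHe | hHne
  · apply le_max_of_le_right
    have hb := cliqIn_bound (G := G) s ∅ t t (by
      intro A hA htA
      have := hlow t H A hH hHmax (by simp [hHe]) (by rw [hHe, Finset.card_empty]; omega)
      rwa [hHe] at this) (n - t) Finset.univ (by simp) (by rw [Finset.card_univ, hV]; omega)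
    refine hb.trans ?_
    obtain ⟨s', rfl⟩ : ∃ s', s = s' + 1 := ⟨s - 1, by omega⟩
    rw [Nat.add_sub_cancel]
    have p1 := Nat.choose_succ_succ' t s'
    rcases (by omega : c = 2 * t ∨ c = 2 * t + 1) with hc | hc
    · obtain ⟨m, hm⟩ : ∃ m, n - t = m + 1 := ⟨n - t - 1, by omega⟩
      rw [hm, show c + 1 - t = t + 1 by omega, show n + t - c - 1 = m by omega, Nat.succ_mul]
      omega
    · obtain ⟨m, hm⟩ : ∃ m, n - t = m + 1 + 1 := ⟨n - t - 2, by omega⟩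
      rw [hm, show c + 1 - t = t + 1 + 1 by omega, show n + t - c - 1 = m by omega, Nat.succ_mul,
        Nat.succ_mul]
      have p2 := Nat.choose_succ_succ' (t + 1) s'
      have p3 : t.choose s' ≤ (t + 1).choose s' := Nat.choose_le_succ _ _
      omega
  · have hclq : ∀ x ∈ H, ∀ y ∈ H, x ≠ y → G.Adj x y := fun x hx y hy hxy =>
      allAdj hG h2 hno hmax H H (t + 1) (t + 1) hH hH (by omega) (by omega) (by omega) x y hx hy hxy
    have hfil : ∀ x ∈ H, H.filter (G.Adj x) = H.erase x := by
      intro x hx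
      ext y
      simp only [Finset.mem_filter, Finset.mem_erase]
      constructor
      · rintro ⟨hy, h⟩; exact ⟨h.ne', hy⟩
      · rintro ⟨h, hy⟩; exact ⟨hy, hclq x hx y hy h.symm⟩
    have hfc : ∀ x ∈ H, (H.filter (G.Adj x)).card = H.card - 1 := fun x hx => by
      rw [hfil x hx, Finset.card_erase_of_mem hx]
    have hr1 : t + 2 ≤ H.card := by
      obtain ⟨x, hx⟩ := hHne
      have a1 := hH x hx
      rw [hfc x hx] at a1
      omega
    have hr2 : H.card ≤ c := by
      obtain ⟨x, w, hw, hwl⟩ := clique_cycle H hclq (by omega)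
      have := hno x w hw
      omega
    obtain ⟨H', hH', hHmax'⟩ := exists_core (G := G) (c + 1 - H.card + 1)
    have hsub1 : H ⊆ H' := hHmax' H (fun u hu => by have := hH u hu; omega)
    have hadj : ∀ x ∈ H, ∀ y ∈ H', x ≠ y → G.Adj x y := fun x hx y hy hxy =>
      allAdj hG h2 hno hmax H H' (H.card - 1) (c + 1 - H.card + 1) (fun x hx => (hfc x hx).ge) hH'
        (by omega) (by omega) (by omega) x y hx hy hxy
    have hsub2 : H' ⊆ H := by
      intro y hy
      by_contra hyH
      apply hyH
      refine hHmax (insert y H) ?_ (Finset.mem_insert_self _ _)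
      intro u hu
      rw [Finset.mem_insert] at hu
      rcases hu with rfl | hu
      · have : H ⊆ (insert u H).filter (G.Adj u) := by
          intro x hx
          rw [Finset.mem_filter]
          exact ⟨Finset.mem_insert_of_mem hx, (hadj x hx u hy (fun h => hyH (h ▸ hx))).symm⟩
        have := Finset.card_le_card this
        omega
      · exact (hH u hu).trans (Finset.card_le_card
          (Finset.filter_subset_filter _ (Finset.subset_insert _ _)))
    have hHH : H' = H := Finset.Subset.antisymm hsub2 hsub1
    rw [hHH] at hH' hHmax'
    have hk : k ≤ c + 1 - H.card := by
      by_contra hcon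
      have h5 : Finset.univ ⊆ H := hHmax' Finset.univ (fun u _ => by
        have := hdeg u; omega)
      have := Finset.card_le_card h5
      rw [Finset.card_univ, hV] at this
      omega
    have hrn : H.card ≤ n := by rw [← hV]; exact Finset.card_le_univ H
    have hb := cliqIn_bound (G := G) s H H.card (c + 1 - H.card)
      (fun A hHA hc => hlow _ H A hH' hHmax' hHA hc) (n - H.card) Finset.univ (by simp)
      (by rw [Finset.card_univ, hV]; omega)
    have hf := f_quasi n c s k t (c + 1 - H.card) h1 (by omega) hk (by omega)
    rw [show c + 1 - (c + 1 - H.card) = H.card by omega,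
      show n + (c + 1 - H.card) - c - 1 = n - H.card by omega] at hf
    exact hb.trans hf
end

theorem stmt18 (n c k s : ℕ) (h1 : c ≤ n - 1) (h2 : 4 ≤ c) (h3 : 2 ≤ s) (h4 : 2 ≤ k)
    (V : Type) (G : SimpleGraph V) (hV : Nat.card V = n) (hconn : TwoConnected G)
    (hcirc : circ G = c) (hdeg : ∀ v, k ≤ degN G v) :
    cliquesN G s ≤ max (fCliques n c k s) (fCliques n c (c / 2) s) := by
  classical
  have hfin : Finite V := Nat.finite_of_card_ne_zero (by omega)
  have := Fintype.ofFinite V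
  have hno : ∀ (x : V) (w : G.Walk x x), w.IsCycle → w.length ≤ c := by
    intro x w hw
    rw [← hcirc]
    refine le_csSup ⟨Fintype.card V, ?_⟩ ⟨x, w, hw, rfl⟩
    rintro m ⟨y, p, hp, rfl⟩
    have h5 := List.Nodup.length_le_card hp.support_nodup
    simpa using h5
  obtain ⟨G', hle, hmaxl⟩ := Finite.exists_le_maximal
    (p := fun G : SimpleGraph V => ∀ (x : V) (w : G.Walk x x), w.IsCycle → w.length ≤ c) hno
  have hG' : ∀ z : V, (G'.induce {u | u ≠ z}).Connected := fun z =>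
    (hconn.2 z).mono (fun a b hab => hle hab)
  have hV' : Fintype.card V = n := by rw [← hV, Nat.card_eq_fintype_card]
  have hmain := core_main (G := G') n c k s (by omega) h2 h3 hV' hG' hmaxl.1
    (hmax_of_maximal hmaxl) (by
      intro v
      refine (hdeg v).trans ?_
      unfold degN
      rw [Nat.card_eq_fintype_card, ← Set.toFinset_card]
      apply Finset.card_le_card
      intro x hx
      rw [Set.mem_toFinset, mem_neighborSet] at hx
      simpa using hle hx)
  refine le_trans ?_ hmain
  unfold cliquesN cliqIn
  refine Nat.card_le_card_of_injective
    (fun S => ⟨S.1, Finset.subset_univ _, S.2.mono hle⟩) ?_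
  intro S T h
  exact Subtype.ext (Subtype.mk.inj h)
end
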